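/- Suppose d ≥ 2 is even. Then: (i) for every Schwartz–Bruhat function Φ on ℚ_p^d there exists a Schwartz–Bruhat function Φ₂ on ℚ_p² such that, setting h(ξ) = ∫_{ℚ_p∖{0}} Φ₂(a, ξ/a) |a|_p^{(d−2)/2} da/|a|_p (an integral converging for every ξ ≠ 0 and defining a locally integrable function on ℚ_p), one has ∫_{ℚ_p^d} g(q_d(x)) Φ(x) dx = ∫_{ℚ_p} g(ξ) h(ξ) dξ for every continuous compactly supported g : ℚ_p → ℂ; and (ii) conversely, for every Schwartz–Bruhat Φ₂ on ℚ_p² there exists a Schwartz–Bruhat Φ on ℚ_p^d for which the same identity holds. -/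

import Mathlib

open MeasureTheory Filter

noncomputable section

/-- A Schwartz–Bruhat function: locally constant with compact support. -/
def IsSchwartzBruhat {X : Type*} [TopologicalSpace X] (f : X → ℂ) : Prop :=
  IsLocallyConstant f ∧ HasCompactSupport f

/-- Extension of a vector in `ℚ_p^d` by zeros, for convenient indexing. -/
def padP {p : ℕ} [Fact p.Prime] {d : ℕ} (x : Fin d → ℚ_[p]) (n : ℕ) : ℚ_[p] :=
  if h : n < d then x ⟨n, h⟩ else 0

/-- The split quadratic form `q_d` on `ℚ_p^d`:
`x₁x₂ + x₃x₄ + ⋯ + x_{d−1}x_d` for `d` even, and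
`x₁² + x₂x₃ + ⋯ + x_{d−1}x_d` for `d` odd. -/
def splitQP (p : ℕ) [Fact p.Prime] (d : ℕ) (x : Fin d → ℚ_[p]) : ℚ_[p] :=
  if Even d then ∑ i ∈ Finset.range (d / 2), padP x (2 * i) * padP x (2 * i + 1)
  else padP x 0 ^ 2 + ∑ i ∈ Finset.range (d / 2), padP x (2 * i + 1) * padP x (2 * i + 2)

/-- The twisted pushforward
`h(ξ) = ∫_{ℚ_p∖{0}} Φ₂(a, ξ/a) |a|_p^{(d−2)/2} da/|a|_p`. -/
def hTwoP (p : ℕ) [Fact p.Prime] [MeasurableSpace ℚ_[p]] (μ : Measure ℚ_[p]) (d : ℕ)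
    (Φ₂ : ℚ_[p] × ℚ_[p] → ℂ) (ξ : ℚ_[p]) : ℂ :=
  ∫ a in ({0}ᶜ : Set ℚ_[p]), Φ₂ (a, ξ / a) * ((‖a‖ ^ (((d : ℝ) - 2) / 2) / ‖a‖ : ℝ) : ℂ) ∂μ

open scoped ENNReal NNReal


section aux
variable {p : ℕ} [Fact p.Prime] 

lemma ball_succ [MeasurableSpace ℚ_[p]] [BorelSpace ℚ_[p]]
    (μ : Measure ℚ_[p]) [μ.IsAddHaarMeasure] (k : ℤ) :
    μ (Metric.closedBall 0 ((p:ℝ)^(k+1))) = p * μ (Metric.closedBall 0 ((p:ℝ)^k)) := by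
  have hp : (p:ℚ_[p]) ≠ 0 := by exact_mod_cast (Fact.out : p.Prime).ne_zero
  have hp1 : (1:ℝ) < p := by exact_mod_cast (Fact.out : p.Prime).one_lt
  have hp0 : (0:ℝ) < p := by linarith
  have hn : ∀ j : ℤ, ‖(p:ℚ_[p])^j‖ = (p:ℝ)^(-j) := fun j => Padic.norm_p_zpow j
  have hcov : Metric.closedBall (0:ℚ_[p]) ((p:ℝ)^(k+1)) =
      ⋃ i ∈ Finset.range p, Metric.closedBall ((i:ℚ_[p]) * (p:ℚ_[p])^(-(k+1))) ((p:ℝ)^k) := by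
    ext x
    simp only [Metric.mem_closedBall, Set.mem_iUnion, Finset.mem_range, dist_eq_norm, sub_zero]
    constructor
    · intro hx
      have hy : ‖x * (p:ℚ_[p])^(k+1)‖ ≤ 1 := by
        rw [norm_mul, hn]
        calc _ ≤ (p:ℝ)^(k+1) * (p:ℝ)^(-(k+1)) := by gcongr
          _ = 1 := by rw [← zpow_add₀ hp0.ne']; simp
      let y : ℤ_[p] := ⟨_, hy⟩
      refine ⟨y.zmodRepr, PadicInt.zmodRepr_lt_p _, ?_⟩
      have h := PadicInt.norm_sub_zmodRepr_lt_one y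
      rw [PadicInt.norm_def] at h
      push_cast at h
      change ‖x * (p:ℚ_[p])^(k+1) - (y.zmodRepr : ℚ_[p])‖ < 1 at h
      generalize y.zmodRepr = i at *
      rw [Padic.norm_le_pow_iff_norm_lt_pow_add_one]
      have : x - i * (p:ℚ_[p])^(-(k+1)) = (x * (p:ℚ_[p])^(k+1) - i) * (p:ℚ_[p])^(-(k+1)) := by
        rw [sub_mul, mul_assoc x, ← zpow_add₀ hp]; simp
      rw [this, norm_mul, hn, neg_neg]
      have : (0:ℝ) < (p:ℝ)^(k+1) := by positivity
      nlinarith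
    · rintro ⟨i, hi, h⟩
      have h2 : ‖(i:ℚ_[p]) * (p:ℚ_[p])^(-(k+1))‖ ≤ (p:ℝ)^(k+1) := by
        rw [norm_mul, hn, neg_neg]
        have := Padic.norm_int_le_one (p := p) i
        have h3 : (0:ℝ) < (p:ℝ)^(k+1) := by positivity
        push_cast at this
        nlinarith
      have h3 : (p:ℝ)^k ≤ (p:ℝ)^(k+1) := zpow_le_zpow_right₀ hp1.le (by lia)
      calc ‖x‖ = ‖(x - i * (p:ℚ_[p])^(-(k+1))) + i * (p:ℚ_[p])^(-(k+1))‖ := by simp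
        _ ≤ _ := (IsUltrametricDist.norm_add_le_max _ _).trans (max_le (h.trans h3) h2)
  rw [hcov, measure_biUnion_finset]
  · simp_rw [Measure.addHaar_closedBall_center]
    simp
  · intro i hi j hj hij
    simp only [Finset.coe_range, Set.mem_Iio] at hi hj
    rw [Function.onFun, Set.disjoint_left]
    intro x hx hy
    rw [Metric.mem_closedBall, dist_eq_norm] at hx hy
    have h : ‖((i:ℚ_[p]) - j) * (p:ℚ_[p])^(-(k+1))‖ ≤ (p:ℝ)^k := by
      have : ((i:ℚ_[p]) - j) * (p:ℚ_[p])^(-(k+1)) = (x - j * (p:ℚ_[p])^(-(k+1))) - (x - i * (p:ℚ_[p])^(-(k+1))) := by ring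
      rw [this, sub_eq_add_neg]
      exact (IsUltrametricDist.norm_add_le_max _ _).trans (max_le hy (by rwa [norm_neg]))
    rw [norm_mul, hn, neg_neg, zpow_add_one₀ hp0.ne'] at h
    have h3 : (0:ℝ) < (p:ℝ)^k := by positivity
    have h4 : ‖((i:ℚ_[p]) - j)‖ < 1 := by
      by_contra! hc
      have : 1 * ((p:ℝ)^k * p) ≤ ‖((i:ℚ_[p]) - j)‖ * ((p:ℝ)^k * p) := by gcongr
      nlinarith
    have h5 : ‖(((i:ℤ) - j : ℤ) : ℚ_[p])‖ < 1 := by push_cast; exact h4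
    rw [Padic.norm_intCast_lt_one_iff] at h5
    have := Int.eq_zero_of_abs_lt_dvd h5 (by rw [abs_lt]; lia)
    lia
  · intro i _
    exact Metric.isClosed_closedBall.measurableSet

lemma ball_zpow [MeasurableSpace ℚ_[p]] [BorelSpace ℚ_[p]]
    (μ : Measure ℚ_[p]) [μ.IsAddHaarMeasure] (k : ℤ) :
    μ (Metric.closedBall 0 ((p:ℝ)^k)) = ENNReal.ofReal ((p:ℝ)^k) * μ (Metric.closedBall 0 1) := by
  have hp0 : (0:ℝ) < p := by exact_mod_cast (Fact.out : p.Prime).pos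
  have hpe : (p:ℝ≥0∞) = ENNReal.ofReal p := by simp
  induction k using Int.induction_on with
  | zero => simp
  | succ i ih =>
    rw [ball_succ, ih, ← mul_assoc, hpe, ← ENNReal.ofReal_mul hp0.le, zpow_add_one₀ hp0.ne', mul_comm (p:ℝ)]
  | pred i ih =>
    have := ball_succ μ (-(i:ℤ) - 1)
    rw [sub_add_cancel, ih] at this
    have h2 : (p:ℝ)^(-(i:ℤ)) = p * (p:ℝ)^(-(i:ℤ)-1) := by
      rw [mul_comm, ← zpow_add_one₀ hp0.ne']; simp
    rw [h2, ENNReal.ofReal_mul hp0.le, ← hpe, mul_assoc] at this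
    refine ((ENNReal.mul_right_inj ?_ ?_).1 this).symm
    · simpa using (Fact.out : p.Prime).ne_zero
    · simp

lemma ball_norm [MeasurableSpace ℚ_[p]] [BorelSpace ℚ_[p]]
    (μ : Measure ℚ_[p]) [μ.IsAddHaarMeasure] (a : ℚ_[p]) (ha : a ≠ 0) :
    μ (Metric.closedBall 0 ‖a‖) = ENNReal.ofReal ‖a‖ * μ (Metric.closedBall 0 1) := by
  rw [Padic.norm_eq_zpow_neg_valuation ha, ball_zpow]

lemma map_smul_pi [MeasurableSpace ℚ_[p]] [BorelSpace ℚ_[p]]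
    (μ : Measure ℚ_[p]) [μ.IsAddHaarMeasure] {κ : Type*} [Fintype κ] (a : ℚ_[p]) (ha : a ≠ 0) :
    ENNReal.ofReal (‖a‖ ^ Fintype.card κ) • 
      Measure.map (fun u : κ → ℚ_[p] => a • u) (Measure.pi fun _ : κ => μ) = Measure.pi fun _ : κ => μ := by
  classical
  set ν := Measure.pi fun _ : κ => μ with hν
  have hH : (Measure.map (fun u : κ → ℚ_[p] => a • u) ν).IsAddHaarMeasure :=
    (ContinuousLinearEquiv.smulLeft (R₁ := ℚ_[p]) (M₁ := κ → ℚ_[p]) (Units.mk0 a ha)).isAddHaarMeasure_map ν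
  have hm : Measurable (fun u : κ → ℚ_[p] => a • u) := (continuous_const_smul a).measurable
  have h := Measure.isAddLeftInvariant_eq_smul (Measure.map (fun u : κ → ℚ_[p] => a • u) ν) ν
  set c := (Measure.map (fun u : κ → ℚ_[p] => a • u) ν).addHaarScalarFactor ν
  have hb := congrArg (fun m => m (Set.univ.pi fun _ : κ => Metric.closedBall (0:ℚ_[p]) ‖a‖)) h
  have hb1 : μ (Metric.closedBall 0 1) ≠ 0 := (Metric.measure_closedBall_pos μ 0 one_pos).ne'
  have hb2 : μ (Metric.closedBall 0 1) ≠ ⊤ := (isCompact_closedBall _ _).measure_lt_top.ne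
  have hap : 0 < ‖a‖ := norm_pos_iff.2 ha
  have hpre : (fun u : κ → ℚ_[p] => a • u) ⁻¹' (Set.univ.pi fun _ : κ => Metric.closedBall (0:ℚ_[p]) ‖a‖)
    = Set.univ.pi fun _ : κ => Metric.closedBall (0:ℚ_[p]) 1 := by
    ext u
    simp [Set.mem_pi, hap]
  rw [Measure.map_apply hm (MeasurableSet.univ_pi fun _ => Metric.isClosed_closedBall.measurableSet), hpre,
    Measure.smul_apply, hν, Measure.pi_pi, Measure.pi_pi] at hb
  simp only [ball_norm μ a ha, Finset.prod_const, Finset.card_univ, mul_pow] at hb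
  have hc : ENNReal.ofReal (‖a‖ ^ Fintype.card κ) * (c : ℝ≥0∞) = 1 := by
    have h1 : μ (Metric.closedBall 0 1) ^ Fintype.card κ ≠ 0 := pow_ne_zero _ hb1
    have h2 : μ (Metric.closedBall 0 1) ^ Fintype.card κ ≠ ⊤ := ENNReal.pow_ne_top hb2
    rw [ENNReal.ofReal_pow hap.le]
    refine (ENNReal.mul_left_inj h1 h2).1 ?_
    rw [one_mul]
    conv_rhs => rw [hb]
    simp only [ENNReal.smul_def, smul_eq_mul]
    ring
  rw [h]
  change _ • ((c : ℝ≥0∞) • ν) = ν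
  rw [smul_smul, hc, one_smul]

lemma map_mul_one [MeasurableSpace ℚ_[p]] [BorelSpace ℚ_[p]]
    (μ : Measure ℚ_[p]) [μ.IsAddHaarMeasure] (a : ℚ_[p]) (ha : a ≠ 0) :
    ENNReal.ofReal ‖a‖ • Measure.map (fun u : ℚ_[p] => a * u) μ = μ := by
  have h := map_smul_pi μ (κ := Unit) a ha
  have h1 := measurePreserving_funUnique μ Unit
  have h2 := congrArg (Measure.map (MeasurableEquiv.funUnique Unit ℚ_[p])) h
  have hm : Measurable (fun u : Unit → ℚ_[p] => a • u) := (continuous_const_smul a).measurable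
  have hm2 : Measurable (fun u : ℚ_[p] => a * u) := (continuous_const_mul a).measurable
  rw [Measure.map_smul, Measure.map_map (MeasurableEquiv.measurable _) hm, h1.map_eq] at h2
  have h3 : (MeasurableEquiv.funUnique Unit ℚ_[p]) ∘ (fun u : Unit → ℚ_[p] => a • u)
    = (fun u : ℚ_[p] => a * u) ∘ (MeasurableEquiv.funUnique Unit ℚ_[p]) := by
    ext u; simp
  rw [h3, ← Measure.map_map hm2 (MeasurableEquiv.measurable _), h1.map_eq] at h2
  simpa using h2

lemma map_skew [MeasurableSpace ℚ_[p]] [BorelSpace ℚ_[p]]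
    (μ : Measure ℚ_[p]) [μ.IsAddHaarMeasure] {X : Type*} [MeasurableSpace X] (ρ : Measure X) [SFinite ρ]
    (w : ℚ_[p] → ℝ≥0∞) (hw : Measurable w) (T : ℚ_[p] → X → X) (hT : Measurable (Function.uncurry T))
    (h : ∀ a, a ≠ 0 → w a • Measure.map (T a) ρ = ρ) :
    Measure.map (fun z : ℚ_[p] × X => (z.1, T z.1 z.2)) ((μ.prod ρ).withDensity (fun z => w z.1)) = μ.prod ρ := by
  have hS : Measurable (fun z : ℚ_[p] × X => (z.1, T z.1 z.2)) := measurable_fst.prodMk hT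
  refine Measure.ext_of_lintegral _ fun f hf => ?_
  rw [lintegral_map hf hS]
  have e1 := lintegral_withDensity_eq_lintegral_mul (μ.prod ρ) (hw.comp (measurable_fst (β := X))) (hf.comp hS)
  refine e1.trans ?_
  simp only [Pi.mul_apply, Function.comp_apply]
  have hfS := hf.comp hS
  simp only [Function.comp_def] at hfS
  rw [lintegral_prod _ (by fun_prop), lintegral_prod _ (by fun_prop)]
  have h0 : ∀ᵐ a ∂μ, a ≠ 0 := by
    simp [ae_iff]
  refine lintegral_congr_ae (h0.mono fun a ha => ?_)
  have hTa : Measurable (T a) := by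
    have := hT.comp (measurable_prodMk_left (x := a)); exact this
  simp only
  rw [lintegral_const_mul _ (by fun_prop)]
  conv_rhs => rw [← h a ha]
  rw [lintegral_smul_measure, lintegral_map (by fun_prop) hTa]
  rfl

lemma integral_skew [MeasurableSpace ℚ_[p]] [BorelSpace ℚ_[p]]
    (μ : Measure ℚ_[p]) [μ.IsAddHaarMeasure] {X : Type*} [MeasurableSpace X] (ρ : Measure X) [SFinite ρ]
    (w : ℚ_[p] → ℝ) (hw0 : ∀ a, 0 ≤ w a) (hw : Measurable w) (T : ℚ_[p] → X → X) (hT : Measurable (Function.uncurry T))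
    (h : ∀ a, a ≠ 0 → ENNReal.ofReal (w a) • Measure.map (T a) ρ = ρ)
    (f : ℚ_[p] × X → ℂ) (hf : AEStronglyMeasurable f (μ.prod ρ)) :
    (∫ z, f z ∂(μ.prod ρ) = ∫ z, (w z.1 : ℂ) * f (z.1, T z.1 z.2) ∂(μ.prod ρ)) ∧
    (Integrable (fun z => (w z.1 : ℂ) * f (z.1, T z.1 z.2)) (μ.prod ρ) → Integrable f (μ.prod ρ)) := by
  have hS : Measurable (fun z : ℚ_[p] × X => (z.1, T z.1 z.2)) := measurable_fst.prodMk hT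
  have key := map_skew μ ρ (fun a => ENNReal.ofReal (w a)) (by fun_prop) T hT h
  have hww : Measurable (fun z : ℚ_[p] × X => (w z.1).toNNReal) := by fun_prop
  have hf2 := hf
  rw [← key] at hf2
  constructor
  · conv_lhs => rw [← key]
    rw [integral_map hS.aemeasurable hf2]
    have := integral_withDensity_eq_integral_smul (μ := μ.prod ρ) hww (fun z : ℚ_[p] × X => f (z.1, T z.1 z.2))
    refine this.trans (integral_congr_ae (Eventually.of_forall fun z => ?_))
    simp [NNReal.smul_def, hw0]
  · intro hi
    rw [← key, integrable_map_measure hf2 hS.aemeasurable]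
    refine (integrable_withDensity_iff_integrable_smul hww).2 (hi.congr (Eventually.of_forall fun z => ?_))
    simp [NNReal.smul_def, hw0]

variable {κ : Type*} [Fintype κ]

/-- fibre coordinate change -/
noncomputable def fibT (a : ℚ_[p]) (z : ((κ → ℚ_[p]) × (κ → ℚ_[p])) × ℚ_[p]) : ((κ → ℚ_[p]) × (κ → ℚ_[p])) × ℚ_[p] :=
  ((a • z.1.1, z.1.2), z.2 - z.1.1 ⬝ᵥ z.1.2)

lemma fibT_cont : Continuous (Function.uncurry (fibT (p := p) (κ := κ))) := by
  unfold fibT Function.uncurry dotProduct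
  fun_prop

lemma fibT_map [MeasurableSpace ℚ_[p]] [BorelSpace ℚ_[p]]
    (μ : Measure ℚ_[p]) [μ.IsAddHaarMeasure] (a : ℚ_[p]) (ha : a ≠ 0) :
    ENNReal.ofReal (‖a‖ ^ Fintype.card κ) • Measure.map (fibT (κ := κ) a) 
      (((Measure.pi fun _ : κ => μ).prod (Measure.pi fun _ : κ => μ)).prod μ)
      = (((Measure.pi fun _ : κ => μ).prod (Measure.pi fun _ : κ => μ)).prod μ) := by
  set ν := Measure.pi fun _ : κ => μ with hν
  have hdot : Continuous fun z : ((κ → ℚ_[p]) × (κ → ℚ_[p])) × ℚ_[p] => z.2 - z.1.1 ⬝ᵥ z.1.2 := by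
    unfold dotProduct; fun_prop
  have h1 : MeasurePreserving (fun z : ((κ → ℚ_[p]) × (κ → ℚ_[p])) × ℚ_[p] => (z.1, z.2 - z.1.1 ⬝ᵥ z.1.2))
      ((ν.prod ν).prod μ) ((ν.prod ν).prod μ) := by
    refine MeasurePreserving.skew_product (f := id) (g := fun (w : (κ → ℚ_[p]) × (κ → ℚ_[p])) b => b - w.1 ⬝ᵥ w.2)
      (MeasurePreserving.id _) hdot.measurable (Eventually.of_forall fun w => ?_)
    exact (measurePreserving_sub_right μ _).map_eq
  have hm : Measurable (fun u : κ → ℚ_[p] => a • u) := (continuous_const_smul a).measurable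
  have h2 : (fibT (κ := κ) a) = (Prod.map (Prod.map (fun u => a • u) id) id) ∘
     (fun z : ((κ → ℚ_[p]) × (κ → ℚ_[p])) × ℚ_[p] => (z.1, z.2 - z.1.1 ⬝ᵥ z.1.2)) := rfl
  rw [h2, ← Measure.map_map (by fun_prop) h1.measurable, h1.map_eq]
  have hs : SFinite (Measure.map (fun u : κ → ℚ_[p] => a • u) ν) := inferInstance
  rw [← Measure.map_prod_map _ _ (by fun_prop) measurable_id, ← Measure.map_prod_map _ _ hm measurable_id,
    Measure.map_id, Measure.map_id, ← Measure.prod_smul_left, ← Measure.prod_smul_left, map_smul_pi μ a ha]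

lemma hTwo_skew [MeasurableSpace ℚ_[p]] [BorelSpace ℚ_[p]]
    (μ : Measure ℚ_[p]) [μ.IsAddHaarMeasure] (f : ℚ_[p] × ℚ_[p] → ℂ) (hf : AEStronglyMeasurable f (μ.prod μ)) :
    (∫ z, f z ∂(μ.prod μ) = ∫ z, (‖z.1‖ : ℂ) * f (z.1, z.1 * z.2) ∂(μ.prod μ)) ∧
    (Integrable (fun z => (‖z.1‖ : ℂ) * f (z.1, z.1 * z.2)) (μ.prod μ) → Integrable f (μ.prod μ)) :=
  integral_skew μ μ (fun a => ‖a‖) (fun a => norm_nonneg a) (by fun_prop) (fun a b => a * b)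
    (by unfold Function.uncurry; fun_prop) (fun a ha => map_mul_one μ a ha) f hf

lemma SB_intro {X : Type*} [TopologicalSpace X] [R1Space X] {f : X → ℂ} (h : IsLocallyConstant f)
    {K : Set X} (hK : IsCompact K) (h0 : ∀ x ∉ K, f x = 0) : IsSchwartzBruhat f :=
  ⟨h, HasCompactSupport.intro hK h0⟩

lemma SB_zero {X : Type*} [TopologicalSpace X] {f : X → ℂ} (h : IsSchwartzBruhat f)
    {x : X} (hx : x ∉ tsupport f) : f x = 0 := image_eq_zero_of_notMem_tsupport hx

lemma lc_ind {X : Type*} [TopologicalSpace X] {C : Set X} (hC : IsClopen C) :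
    IsLocallyConstant (C.indicator (1 : X → ℂ)) := by
  rw [IsLocallyConstant.iff_exists_open]
  intro x
  by_cases hx : x ∈ C
  · exact ⟨C, hC.2, hx, fun y hy => by simp [hx, hy]⟩
  · exact ⟨Cᶜ, hC.1.isOpen_compl, hx, fun y hy => by simp [hx, Set.indicator_of_notMem (show y ∉ C from hy)]⟩

lemma SB_integrable {X : Type*} [TopologicalSpace X] [MeasurableSpace X] [OpensMeasurableSpace X]
    (m : Measure X) [IsFiniteMeasureOnCompacts m] {c f : X → ℂ} (hc : Continuous c) (hf : IsSchwartzBruhat f) :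
    Integrable (fun x => c x * f x) m :=
  (hc.mul hf.1.continuous).integrable_of_hasCompactSupport hf.2.mul_left

lemma SB_integral {X W : Type*} [TopologicalSpace X] [R1Space X] [TopologicalSpace W] [MeasurableSpace W] (ρ : Measure W)
    {F : X × W → ℂ} (hF : IsSchwartzBruhat F) : IsSchwartzBruhat (fun x => ∫ w, F (x, w) ∂ρ) := by
  have hK : IsCompact (tsupport F) := hF.2
  refine SB_intro ?_ (hK.image continuous_fst) ?_
  · rw [IsLocallyConstant.iff_exists_open]
    intro x
    have hop : IsOpen {z : X × W | F z = F (x, z.2)} := by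
      rw [isOpen_iff_mem_nhds]
      rintro ⟨a, w⟩ hz
      have h1 := (IsLocallyConstant.iff_eventually_eq _).1 hF.1 (a, w)
      have h2 := (IsLocallyConstant.iff_eventually_eq _).1 (hF.1.comp_continuous (f := fun z : X × W => (x, z.2)) (by fun_prop)) (a, w)
      filter_upwards [h1, h2] with z h1 h2
      simp only [Set.mem_ofPred_eq, Function.comp] at *
      rw [h1, h2, hz]
    obtain ⟨u, v, hu, hv, hxu, hKv, huv⟩ := generalized_tube_lemma (isCompact_singleton (x := x))
      (hK.image continuous_snd) hop (by rintro ⟨a, w⟩ ⟨rfl, h⟩; rfl)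
    refine ⟨u, hu, hxu rfl, fun y hy => integral_congr_ae (Eventually.of_forall fun w => ?_)⟩
    by_cases hw : w ∈ Prod.snd '' tsupport F
    · exact huv ⟨hy, hKv hw⟩
    · have : ∀ a, F (a, w) = 0 := fun a => SB_zero hF fun h => hw ⟨_, h, rfl⟩
      simp [this]
  · intro x hx
    have : ∀ w, F (x, w) = 0 := fun a => SB_zero hF fun h => hx ⟨_, h, rfl⟩
    simp [this]

lemma SB_add {X : Type*} [TopologicalSpace X] {f g : X → ℂ} (hf : IsSchwartzBruhat f)
    (hg : IsSchwartzBruhat g) : IsSchwartzBruhat (fun x => f x + g x) :=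
  ⟨hf.1.add hg.1, hf.2.add hg.2⟩

lemma SB_smul {X : Type*} [TopologicalSpace X] {f : X → ℂ} (c : ℂ) (hf : IsSchwartzBruhat f) :
    IsSchwartzBruhat (fun x => c * f x) :=
  ⟨(IsLocallyConstant.const c).mul hf.1, hf.2.mul_left⟩

lemma SB_sum {X ι : Type*} [TopologicalSpace X] (s : Finset ι) {f : ι → X → ℂ} (hf : ∀ i, IsSchwartzBruhat (f i)) :
    IsSchwartzBruhat (fun x => ∑ i ∈ s, f i x) := by
  classical
  induction s using Finset.induction_on with
  | empty => simpa using ⟨IsLocallyConstant.const 0, HasCompactSupport.zero⟩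
  | insert i s hi ih => simp only [Finset.sum_insert hi]; exact SB_add (hf i) ih

/-- fibre integral -/
noncomputable def TT [MeasurableSpace ℚ_[p]] (μ : Measure ℚ_[p]) (C : Set (κ → ℚ_[p]))
    (Φ : ℚ_[p] × (((κ → ℚ_[p]) × (κ → ℚ_[p])) × ℚ_[p]) → ℂ) (z : ℚ_[p] × ℚ_[p]) : ℂ :=
  ∫ w, C.indicator 1 w.1 * Φ (z.1, fibT z.1 (w, z.2)) ∂((Measure.pi fun _ : κ => μ).prod (Measure.pi fun _ : κ => μ))

lemma SB_K {C : Set (κ → ℚ_[p])} (hC : IsClopen C) (hC2 : IsCompact C)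
    {Φ : ℚ_[p] × (((κ → ℚ_[p]) × (κ → ℚ_[p])) × ℚ_[p]) → ℂ} (hΦ : IsSchwartzBruhat Φ) :
    IsSchwartzBruhat (fun z : ℚ_[p] × (((κ → ℚ_[p]) × (κ → ℚ_[p])) × ℚ_[p]) => C.indicator 1 z.2.1.1 * Φ (z.1, fibT z.1 z.2)) := by
  have hK : IsCompact (tsupport Φ) := hΦ.2
  refine SB_intro (K := (fun q : (ℚ_[p] × (((κ → ℚ_[p]) × (κ → ℚ_[p])) × ℚ_[p])) × (κ → ℚ_[p]) =>
     (q.1.1, ((q.2, q.1.2.1.2), q.1.2.2 + q.2 ⬝ᵥ q.1.2.1.2))) '' (tsupport Φ ×ˢ C)) ?_ ?_ ?_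
  · refine IsLocallyConstant.mul ((lc_ind hC).comp_continuous (by fun_prop)) (hΦ.1.comp_continuous ?_)
    exact continuous_fst.prodMk fibT_cont
  · refine (hK.prod hC2).image ?_
    unfold dotProduct; fun_prop
  · rintro ⟨a, ⟨u, y⟩, b⟩ hz
    by_contra hne
    have h1 : u ∈ C := by
      by_contra h; simp [h] at hne
    have h2 : (a, fibT a ((u, y), b)) ∈ tsupport Φ := by
      by_contra h; simp [SB_zero hΦ h] at hne
    exact hz ⟨(_, u), ⟨h2, h1⟩, by simp [fibT]⟩

lemma SB_TT [MeasurableSpace ℚ_[p]] (μ : Measure ℚ_[p]) {C : Set (κ → ℚ_[p])} (hC : IsClopen C) (hC2 : IsCompact C)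
    {Φ : ℚ_[p] × (((κ → ℚ_[p]) × (κ → ℚ_[p])) × ℚ_[p]) → ℂ} (hΦ : IsSchwartzBruhat Φ) :
    IsSchwartzBruhat (TT μ C Φ) := by
  let e : ((ℚ_[p] × ℚ_[p]) × ((κ → ℚ_[p]) × (κ → ℚ_[p]))) ≃ₜ (ℚ_[p] × (((κ → ℚ_[p]) × (κ → ℚ_[p])) × ℚ_[p])) :=
    { toFun := fun z => (z.1.1, (z.2, z.1.2))
      invFun := fun z => ((z.1, z.2.2), z.2.1)
      left_inv := fun _ => rfl
      right_inv := fun _ => rfl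
      continuous_toFun := by fun_prop
      continuous_invFun := by fun_prop }
  have h := SB_K hC hC2 hΦ
  have h2 : IsSchwartzBruhat ((fun z : ℚ_[p] × (((κ → ℚ_[p]) × (κ → ℚ_[p])) × ℚ_[p]) => C.indicator 1 z.2.1.1 * Φ (z.1, fibT z.1 z.2)) ∘ e) :=
    ⟨h.1.comp_continuous e.continuous, h.2.comp_homeomorph e⟩
  exact SB_integral _ h2

/-- The functional `g ↦ ∫∫ g(ab) Ψ(a,b) |a|^n`. -/
noncomputable def Lf [MeasurableSpace ℚ_[p]] (μ : Measure ℚ_[p]) (n : ℕ) (Ψ : ℚ_[p] × ℚ_[p] → ℂ) (g : ℚ_[p] → ℂ) : ℂ :=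
  ∫ z, (‖z.1‖ : ℂ) ^ n * (g (z.1 * z.2)) * Ψ z ∂(μ.prod μ)

/-- the quadratic form in chart coordinates -/
noncomputable def qq (z : ℚ_[p] × (((κ → ℚ_[p]) × (κ → ℚ_[p])) × ℚ_[p])) : ℚ_[p] := z.1 * z.2.2 + z.2.1.1 ⬝ᵥ z.2.1.2

lemma qq_cont : Continuous (qq (p := p) (κ := κ)) := by
  unfold qq dotProduct; fun_prop

/-- the cone over `C` -/
def cone (C : Set (κ → ℚ_[p])) : Set (ℚ_[p] × (((κ → ℚ_[p]) × (κ → ℚ_[p])) × ℚ_[p])) :=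
  {z | z.1 ≠ 0 ∧ z.1⁻¹ • z.2.1.1 ∈ C}

lemma cone_meas [MeasurableSpace ℚ_[p]] [BorelSpace ℚ_[p]] {C : Set (κ → ℚ_[p])} (hC : MeasurableSet C) : MeasurableSet (cone C) := by
  have h1 : Measurable fun z : ℚ_[p] × (((κ → ℚ_[p]) × (κ → ℚ_[p])) × ℚ_[p]) => z.1⁻¹ • z.2.1.1 := by
    fun_prop
  exact (measurable_fst (measurableSet_singleton 0).compl).inter (h1 hC)

lemma chart [MeasurableSpace ℚ_[p]] [BorelSpace ℚ_[p]]
    (μ : Measure ℚ_[p]) [μ.IsAddHaarMeasure] {C : Set (κ → ℚ_[p])} (hC : IsClopen C) (hC2 : IsCompact C)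
    {Φ : ℚ_[p] × (((κ → ℚ_[p]) × (κ → ℚ_[p])) × ℚ_[p]) → ℂ} (hΦ : IsSchwartzBruhat Φ)
    (g : ℚ_[p] → ℂ) (hg : Continuous g) :
    ∫ z, (cone C).indicator (fun z => g (qq z) * Φ z) z
      ∂(μ.prod (((Measure.pi fun _ : κ => μ).prod (Measure.pi fun _ : κ => μ)).prod μ))
     = Lf μ (Fintype.card κ) (TT μ C Φ) g := by
  set ν := Measure.pi fun _ : κ => μ with hν
  have hI : Integrable (fun z => g (qq z) * Φ z) (μ.prod ((ν.prod ν).prod μ)) :=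
    SB_integrable _ (hg.comp qq_cont) hΦ
  have h1 := (integral_skew μ ((ν.prod ν).prod μ) (fun a => ‖a‖ ^ Fintype.card κ) (fun a => by positivity) (by fun_prop)
    (fibT (κ := κ)) fibT_cont.measurable (fun a ha => fibT_map μ a ha) _
    (hI.aestronglyMeasurable.indicator (cone_meas hC.1.measurableSet))).1
  rw [h1]
  have hcK : Continuous fun z : ℚ_[p] × (((κ → ℚ_[p]) × (κ → ℚ_[p])) × ℚ_[p]) =>
      (‖z.1‖ : ℂ) ^ Fintype.card κ * g (z.1 * z.2.2) := by fun_prop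
  have hK := SB_integrable (μ.prod ((ν.prod ν).prod μ)) hcK (SB_K hC hC2 hΦ)
  have h0 : ∀ᵐ z ∂(μ.prod ((ν.prod ν).prod μ)), z.1 ≠ 0 := by
    have h0 : ∀ᵐ a ∂μ, a ≠ 0 := by simp [ae_iff]
    exact Measure.quasiMeasurePreserving_fst.ae h0
  have h2 : ∀ᵐ z ∂(μ.prod ((ν.prod ν).prod μ)), 
      ((‖z.1‖ ^ Fintype.card κ : ℝ) : ℂ) * (cone C).indicator (fun z => g (qq z) * Φ z) (z.1, fibT z.1 z.2)
      = ((‖z.1‖ : ℂ) ^ Fintype.card κ * g (z.1 * z.2.2)) * (C.indicator 1 z.2.1.1 * Φ (z.1, fibT z.1 z.2)) := by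
    filter_upwards [h0] with z hz
    obtain ⟨a, ⟨u, y⟩, b⟩ := z
    simp only at hz
    have hq : qq (a, fibT a ((u, y), b)) = a * b := by
      simp [qq, fibT, smul_dotProduct]; ring
    by_cases hu : u ∈ C
    · have : (a, fibT a ((u, y), b)) ∈ cone C := by
        simp [cone, fibT, hz, hu, smul_smul]
      rw [Set.indicator_of_mem this, hq]
      simp [hu]; ring
    · have : (a, fibT a ((u, y), b)) ∉ cone C := by
        simp [cone, fibT, hz, hu, smul_smul]
      rw [Set.indicator_of_notMem this]
      simp [hu]
  rw [integral_congr_ae h2, integral_prod _ hK]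
  have hcL : Continuous fun z : ℚ_[p] × ℚ_[p] => (‖z.1‖ : ℂ) ^ Fintype.card κ * g (z.1 * z.2) := by fun_prop
  rw [Lf, integral_prod _ (SB_integrable _ hcL (SB_TT μ hC hC2 hΦ))]
  refine integral_congr_ae (hK.prod_right_ae.mono fun a ha => ?_)
  simp only
  rw [integral_prod_symm _ ha]
  refine integral_congr_ae (Eventually.of_forall fun b => ?_)
  simp only [TT]
  rw [integral_const_mul]

lemma h_aux [MeasurableSpace ℚ_[p]] [BorelSpace ℚ_[p]]
    (μ : Measure ℚ_[p]) [μ.IsAddHaarMeasure] (n : ℕ) 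
    {Ψ : ℚ_[p] × ℚ_[p] → ℂ} (hΨ : IsSchwartzBruhat Ψ) (g : ℚ_[p] → ℂ) (hg : Continuous g) :
    Integrable (fun z : ℚ_[p] × ℚ_[p] => g z.2 * (Ψ (z.1, z.2 / z.1) * ((‖z.1‖ ^ n / ‖z.1‖ : ℝ) : ℂ))) (μ.prod μ) ∧
    ∫ z : ℚ_[p] × ℚ_[p], g z.2 * (Ψ (z.1, z.2 / z.1) * ((‖z.1‖ ^ n / ‖z.1‖ : ℝ) : ℂ)) ∂(μ.prod μ) = Lf μ n Ψ g := by
  have hm : Measurable (fun z : ℚ_[p] × ℚ_[p] => g z.2 * (Ψ (z.1, z.2 / z.1) * ((‖z.1‖ ^ n / ‖z.1‖ : ℝ) : ℂ))) := by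
    have h1 := hΨ.1.continuous.measurable
    have h2 := hg.measurable
    fun_prop
  have h := hTwo_skew μ _ hm.aestronglyMeasurable
  have h0 : ∀ᵐ z ∂(μ.prod μ), z.1 ≠ 0 := by
    have h0 : ∀ᵐ a ∂μ, a ≠ 0 := by simp [ae_iff]
    exact Measure.quasiMeasurePreserving_fst.ae h0
  have h2 : ∀ᵐ z ∂(μ.prod μ), (‖z.1‖ : ℂ) * (g (z.1 * z.2) * (Ψ (z.1, z.1 * z.2 / z.1) * ((‖z.1‖ ^ n / ‖z.1‖ : ℝ) : ℂ)))
      = (‖z.1‖ : ℂ) ^ n * (g (z.1 * z.2)) * Ψ z := by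
    filter_upwards [h0] with z hz
    rw [mul_div_cancel_left₀ _ hz]
    have : (‖z.1‖ : ℂ) ≠ 0 := by simpa using hz
    push_cast
    field_simp
  have hcL : Continuous fun z : ℚ_[p] × ℚ_[p] => (‖z.1‖ : ℂ) ^ n * g (z.1 * z.2) := by fun_prop
  refine ⟨h.2 ((SB_integrable _ hcL hΨ).congr (h2.mono fun z hz => hz.symm)), ?_⟩
  rw [h.1, integral_congr_ae h2, Lf]

lemma hTwoP_eq [MeasurableSpace ℚ_[p]] [BorelSpace ℚ_[p]]
    (μ : Measure ℚ_[p]) [μ.IsAddHaarMeasure] (n : ℕ) (Ψ : ℚ_[p] × ℚ_[p] → ℂ) (ξ : ℚ_[p]) :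
    hTwoP p μ ((n + 1) * 2) Ψ ξ = ∫ a, Ψ (a, ξ / a) * ((‖a‖ ^ n / ‖a‖ : ℝ) : ℂ) ∂μ := by
  have h0 : ∀ᵐ a ∂μ, a ∈ ({0}ᶜ : Set ℚ_[p]) := by simp [ae_iff]
  have he : ((((n + 1) * 2 : ℕ) : ℝ) - 2) / 2 = n := by push_cast; ring
  rw [hTwoP, Measure.restrict_eq_self_of_ae_mem h0, he]
  simp only [Real.rpow_natCast]

lemma part0a [MeasurableSpace ℚ_[p]] [BorelSpace ℚ_[p]]
    (μ : Measure ℚ_[p]) [μ.IsAddHaarMeasure] (n : ℕ) {Ψ : ℚ_[p] × ℚ_[p] → ℂ} (hΨ : IsSchwartzBruhat Ψ)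
    (ξ : ℚ_[p]) (hξ : ξ ≠ 0) :
    Integrable (fun a => Ψ (a, ξ / a) * ((‖a‖ ^ n / ‖a‖ : ℝ) : ℂ)) μ := by
  obtain ⟨R, hR0, hR⟩ := (IsCompact.isBounded (s := tsupport Ψ) hΨ.2).subset_closedBall_lt 0 0
  have hz : ∀ z, R < ‖z‖ → Ψ z = 0 := fun z hz => SB_zero hΨ fun h => by
    have := hR h
    simp at this
    linarith
  refine Continuous.integrable_of_hasCompactSupport ?_ ?_
  · rw [continuous_iff_continuousAt]
    intro a
    by_cases ha : a = 0
    · subst ha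
      have : (fun a => Ψ (a, ξ / a) * ((‖a‖ ^ n / ‖a‖ : ℝ) : ℂ)) =ᶠ[nhds 0] fun _ => 0 := by
        have hb : Metric.ball (0:ℚ_[p]) (‖ξ‖ / R) ∈ nhds 0 := Metric.ball_mem_nhds _ (by positivity)
        filter_upwards [hb] with a ha
        by_cases ha0 : a = 0
        · simp [ha0]
        · rw [hz, zero_mul]
          refine lt_of_lt_of_le ?_ (norm_snd_le _)
          simp only [norm_div]
          rw [mem_ball_zero_iff] at ha
          have : 0 < ‖a‖ := norm_pos_iff.2 ha0
          rw [lt_div_iff₀ this]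
          rw [lt_div_iff₀ hR0] at ha
          linarith
      exact ContinuousAt.congr continuousAt_const this.symm
    · have h1 : ContinuousAt (fun a => Ψ (a, ξ / a)) a :=
        ContinuousAt.comp (f := fun a => (a, ξ / a)) (g := Ψ) hΨ.1.continuous.continuousAt
          (continuousAt_id.prodMk (continuousAt_const.div continuousAt_id ha))
      refine h1.mul (Complex.continuous_ofReal.continuousAt.comp ?_)
      exact ContinuousAt.div (by fun_prop) (by fun_prop) (norm_ne_zero_iff.2 ha)
  · refine HasCompactSupport.intro (isCompact_closedBall (0:ℚ_[p]) R) fun a ha => ?_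
    rw [hz, zero_mul]
    simp at ha
    exact lt_of_lt_of_le ha (norm_fst_le (a, ξ / a))

lemma part0b [MeasurableSpace ℚ_[p]] [BorelSpace ℚ_[p]]
    (μ : Measure ℚ_[p]) [μ.IsAddHaarMeasure] (n : ℕ) {Ψ : ℚ_[p] × ℚ_[p] → ℂ} (hΨ : IsSchwartzBruhat Ψ) :
    Integrable (hTwoP p μ ((n + 1) * 2) Ψ) μ := by
  have h := (h_aux μ n hΨ (fun _ => 1) continuous_const).1.integral_prod_right
  refine h.congr (Eventually.of_forall fun ξ => ?_)
  rw [hTwoP_eq]; simp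

lemma partB [MeasurableSpace ℚ_[p]] [BorelSpace ℚ_[p]]
    (μ : Measure ℚ_[p]) [μ.IsAddHaarMeasure] (n : ℕ) {Ψ : ℚ_[p] × ℚ_[p] → ℂ} (hΨ : IsSchwartzBruhat Ψ)
    (g : ℚ_[p] → ℂ) (hg : Continuous g) :
    ∫ ξ, g ξ * hTwoP p μ ((n + 1) * 2) Ψ ξ ∂μ = Lf μ n Ψ g := by
  have h := h_aux μ n hΨ g hg
  rw [← h.2, integral_prod_symm _ h.1]
  refine integral_congr_ae (Eventually.of_forall fun ξ => ?_)
  simp only [hTwoP_eq, integral_const_mul]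

lemma Lf_add [MeasurableSpace ℚ_[p]] [BorelSpace ℚ_[p]]
    (μ : Measure ℚ_[p]) [μ.IsAddHaarMeasure] (n : ℕ) {Ψ Ψ' : ℚ_[p] × ℚ_[p] → ℂ} (hΨ : IsSchwartzBruhat Ψ)
    (hΨ' : IsSchwartzBruhat Ψ') (g : ℚ_[p] → ℂ) (hg : Continuous g) :
    Lf μ n (fun z => Ψ z + Ψ' z) g = Lf μ n Ψ g + Lf μ n Ψ' g := by
  have hcL : Continuous fun z : ℚ_[p] × ℚ_[p] => (‖z.1‖ : ℂ) ^ n * g (z.1 * z.2) := by fun_prop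
  simp only [Lf, mul_add]
  exact integral_add (SB_integrable _ hcL hΨ) (SB_integrable _ hcL hΨ')

lemma Lf_smul [MeasurableSpace ℚ_[p]] (μ : Measure ℚ_[p]) (n : ℕ) (c : ℂ) (Ψ : ℚ_[p] × ℚ_[p] → ℂ) (g : ℚ_[p] → ℂ) :
    Lf μ n (fun z => c * Ψ z) g = c * Lf μ n Ψ g := by
  simp only [Lf, ← integral_const_mul]
  congr 1; ext z; ring

lemma Lf_sum [MeasurableSpace ℚ_[p]] [BorelSpace ℚ_[p]]
    (μ : Measure ℚ_[p]) [μ.IsAddHaarMeasure] (n : ℕ) {ι : Type*} (s : Finset ι) {Ψ : ι → ℚ_[p] × ℚ_[p] → ℂ}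
    (hΨ : ∀ i, IsSchwartzBruhat (Ψ i)) (g : ℚ_[p] → ℂ) (hg : Continuous g) :
    Lf μ n (fun z => ∑ i ∈ s, Ψ i z) g = ∑ i ∈ s, Lf μ n (Ψ i) g := by
  have hcL : Continuous fun z : ℚ_[p] × ℚ_[p] => (‖z.1‖ : ℂ) ^ n * g (z.1 * z.2) := by fun_prop
  simp only [Lf, Finset.mul_sum]
  exact integral_finsetSum _ fun i _ => SB_integrable _ hcL (hΨ i)

/-- chart coordinates -/
noncomputable def EE {m : ℕ} (i : Fin m) : (Fin (m * 2) → ℚ_[p]) ≃L[ℚ_[p]]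
    (ℚ_[p] × ((({j // j ≠ i} → ℚ_[p]) × ({j // j ≠ i} → ℚ_[p])) × ℚ_[p])) :=
  LinearEquiv.toContinuousLinearEquiv
  { toFun := fun x => (x (finProdFinEquiv (i, 0)), ((fun j => x (finProdFinEquiv (j.1, 0)),
      fun j => x (finProdFinEquiv (j.1, 1))), x (finProdFinEquiv (i, 1))))
    invFun := fun z k => if h : (finProdFinEquiv.symm k).1 = i then
        (if (finProdFinEquiv.symm k).2 = 0 then z.1 else z.2.2)
      else (if (finProdFinEquiv.symm k).2 = 0 then z.2.1.1 ⟨_, h⟩ else z.2.1.2 ⟨_, h⟩)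
    map_add' := fun x y => rfl
    map_smul' := fun c x => rfl
    left_inv := by
      intro x
      ext k
      obtain ⟨⟨j, s⟩, rfl⟩ := finProdFinEquiv.surjective k
      simp only [Equiv.symm_apply_apply]
      fin_cases s <;> by_cases h : j = i <;> simp [h]
    right_inv := by
      rintro ⟨a, ⟨u, y⟩, b⟩
      simp only [Equiv.symm_apply_apply]
      refine Prod.ext (by simp) (Prod.ext (Prod.ext ?_ ?_) (by simp))
      · ext j; simp [j.2]
      · ext j; simp [j.2] }

lemma EE_apply {m : ℕ} (i : Fin m) (x : Fin (m * 2) → ℚ_[p]) :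
    EE i x = (x (finProdFinEquiv (i, 0)), ((fun j => x (finProdFinEquiv (j.1, 0)),
      fun j => x (finProdFinEquiv (j.1, 1))), x (finProdFinEquiv (i, 1)))) := rfl

lemma splitQP_eq {m : ℕ} (x : Fin (m * 2) → ℚ_[p]) :
    splitQP p (m * 2) x = ∑ j : Fin m, x (finProdFinEquiv (j, 0)) * x (finProdFinEquiv (j, 1)) := by
  have h1 : Even (m * 2) := by simp
  rw [splitQP, if_pos h1, Nat.mul_div_cancel _ two_pos, Finset.sum_range]
  refine Finset.sum_congr rfl fun j _ => ?_
  have hj := j.2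
  have a1 : 2 * (j : ℕ) < m * 2 := by lia
  have a2 : 2 * (j : ℕ) + 1 < m * 2 := by lia
  simp only [padP, a1, a2, dif_pos]
  congr 2 <;> ext <;> simp [finProdFinEquiv, add_comm]

lemma qq_EE {m : ℕ} (i : Fin m) (x : Fin (m * 2) → ℚ_[p]) : qq (EE i x) = splitQP p (m * 2) x := by
  rw [splitQP_eq, EE_apply, qq, ← Fintype.sum_subtype_add_sum_subtype (fun j => j = i)]
  congr 1
  simp
  rfl

/-- the part of the unit polydisc attached to index `i` -/
def CC {m : ℕ} (i : Fin m) : Set ({j // j ≠ i} → ℚ_[p]) :=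
  Set.univ.pi fun j => if j.1 < i then Metric.ball 0 1 else Metric.closedBall 0 1

lemma CC_clopen {m : ℕ} (i : Fin m) : IsClopen (CC (p := p) i) := by
  have h : ∀ j : {j // j ≠ i}, IsClopen (if j.1 < i then Metric.ball (0:ℚ_[p]) 1 else Metric.closedBall 0 1) := by
    intro j
    split_ifs
    · exact IsUltrametricDist.isClopen_ball _ _
    · exact IsUltrametricDist.isClopen_closedBall _ one_ne_zero
  exact ⟨isClosed_set_pi fun j _ => (h j).1, isOpen_set_pi Set.finite_univ fun j _ => (h j).2⟩

lemma CC_sub {m : ℕ} (i : Fin m) {u : {j // j ≠ i} → ℚ_[p]} (hu : u ∈ CC i) : ‖u‖ ≤ 1 := by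
  rw [pi_norm_le_iff_of_nonneg zero_le_one]
  intro j
  have := hu j trivial
  simp only at this
  split_ifs at this
  · exact (mem_ball_zero_iff.1 this).le
  · exact mem_closedBall_zero_iff.1 this

lemma CC_compact {m : ℕ} (i : Fin m) : IsCompact (CC (p := p) i) :=
  (isCompact_closedBall 0 1).of_isClosed_subset (CC_clopen i).1 fun u hu => by
    simpa using CC_sub i hu

lemma mem_cone {m : ℕ} (i : Fin m) (x : Fin (m * 2) → ℚ_[p]) : EE i x ∈ cone (CC i) ↔
    x (finProdFinEquiv (i, 0)) ≠ 0 ∧ ∀ j, j ≠ i → if j < i then ‖x (finProdFinEquiv (j, 0))‖ < ‖x (finProdFinEquiv (i, 0))‖ else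
      ‖x (finProdFinEquiv (j, 0))‖ ≤ ‖x (finProdFinEquiv (i, 0))‖ := by
  rw [EE_apply]
  simp only [cone, CC, Set.mem_ofPred_eq, Set.mem_univ_pi, Subtype.forall]
  refine and_congr_right fun h => forall_congr' fun j => forall_congr' fun hj => ?_
  have hp : 0 < ‖x (finProdFinEquiv (i, 0))‖ := norm_pos_iff.2 h
  split_ifs
  · simp [inv_mul_lt_iff₀ hp]
  · simp [inv_mul_le_iff₀ hp]

lemma exists_cone {m : ℕ} (x : Fin (m * 2) → ℚ_[p]) (k : Fin m) (hk : x (finProdFinEquiv (k, 0)) ≠ 0) :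
    ∃! i : Fin m, EE i x ∈ cone (CC i) := by
  simp only [mem_cone]
  have hne : (Finset.univ : Finset (Fin m)).Nonempty := ⟨k, Finset.mem_univ _⟩
  obtain ⟨i, -, hi⟩ := Finset.exists_max_image Finset.univ
    (fun j : Fin m => toLex (‖x (finProdFinEquiv (j, 0))‖, OrderDual.toDual j)) hne
  simp only [Finset.mem_univ, true_imp_iff, Prod.Lex.toLex_le_toLex, OrderDual.toDual_le_toDual] at hi
  refine ⟨i, ⟨?_, ?_⟩, ?_⟩
  · intro h0
    have := hi k
    rw [h0, norm_zero] at this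
    have h2 := norm_pos_iff.2 hk
    rcases this with h | h <;> linarith [h, h2]
  · intro j hj
    split_ifs with hji
    · rcases hi j with h | h
      · exact h
      · exact absurd h.2 (not_le.2 hji)
    · rcases hi j with h | h
      · exact h.le
      · exact h.1.le
  · rintro i' ⟨h1, h2⟩
    by_contra hne
    have h3 := h2 i (Ne.symm hne)
    rcases hi i' with h | ⟨h, h'⟩
    · split_ifs at h3 <;> linarith
    · rw [if_pos (lt_of_le_of_ne h' (Ne.symm hne))] at h3
      linarith

lemma main_chart [MeasurableSpace ℚ_[p]] [BorelSpace ℚ_[p]]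
    (μ : Measure ℚ_[p]) [μ.IsAddHaarMeasure] {m : ℕ}
    (μd : Measure (Fin (m * 2) → ℚ_[p])) [μd.IsAddHaarMeasure] (i : Fin m) :
    ∃ c : ℝ≥0, 0 < c ∧ Measure.map (EE i) μd =
      c • (μ.prod (((Measure.pi fun _ : {j // j ≠ i} => μ).prod (Measure.pi fun _ : {j // j ≠ i} => μ)).prod μ)) := by
  have hH := (EE (p := p) i).isAddHaarMeasure_map μd
  have i1 : (Measure.pi fun _ : {j // j ≠ i} => μ).IsAddHaarMeasure := inferInstance
  have i2 : ((Measure.pi fun _ : {j // j ≠ i} => μ).prod (Measure.pi fun _ : {j // j ≠ i} => μ)).IsAddHaarMeasure :=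
    Measure.prod.instIsAddHaarMeasure _ _
  have i3 : (((Measure.pi fun _ : {j // j ≠ i} => μ).prod (Measure.pi fun _ : {j // j ≠ i} => μ)).prod μ).IsAddHaarMeasure :=
    Measure.prod.instIsAddHaarMeasure _ _
  have b1 : BorelSpace (({j // j ≠ i} → ℚ_[p]) × ({j // j ≠ i} → ℚ_[p])) := inferInstance
  have b2 : BorelSpace ((({j // j ≠ i} → ℚ_[p]) × ({j // j ≠ i} → ℚ_[p])) × ℚ_[p]) := Prod.borelSpace
  have b3 : MeasurableAdd ((({j // j ≠ i} → ℚ_[p]) × ({j // j ≠ i} → ℚ_[p])) × ℚ_[p]) := ContinuousAdd.measurableAdd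
  have i4 : (μ.prod (((Measure.pi fun _ : {j // j ≠ i} => μ).prod (Measure.pi fun _ : {j // j ≠ i} => μ)).prod μ)).IsAddHaarMeasure :=
    Measure.prod.instIsAddHaarMeasure _ _
  refine ⟨_, ?_, Measure.isAddLeftInvariant_eq_smul _ _⟩
  exact Measure.addHaarScalarFactor_pos_of_isAddHaarMeasure _ _

lemma card_ne' {n : ℕ} (i : Fin (n + 1)) : Fintype.card {j // j ≠ i} = n := by
  simp

lemma main1 [MeasurableSpace ℚ_[p]] [BorelSpace ℚ_[p]]
    (μ : Measure ℚ_[p]) [μ.IsAddHaarMeasure] {n : ℕ}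
    (μd : Measure (Fin ((n + 1) * 2) → ℚ_[p])) [μd.IsAddHaarMeasure] :
    ∃ c : Fin (n + 1) → ℝ, (∀ i, 0 < c i) ∧ 
      (∀ (i : Fin (n + 1)) (f : (ℚ_[p] × ((({j // j ≠ i} → ℚ_[p]) × ({j // j ≠ i} → ℚ_[p])) × ℚ_[p])) → ℂ),
        ∫ x, f (EE i x) ∂μd = c i * ∫ z, f z ∂((μ.prod (((Measure.pi fun _ : {j // j ≠ i} => μ).prod (Measure.pi fun _ : {j // j ≠ i} => μ)).prod μ)))) ∧
      ∀ Φ : (Fin ((n + 1) * 2) → ℚ_[p]) → ℂ, IsSchwartzBruhat Φ → ∀ g : ℚ_[p] → ℂ, Continuous g →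
        ∫ x, g (splitQP p ((n + 1) * 2) x) * Φ x ∂μd = ∑ i, c i * Lf μ n (TT μ (CC i) (Φ ∘ (EE i).symm)) g := by
  choose c hc0 hc using main_chart μ μd
  have hint : (∀ (i : Fin (n + 1)) (f : (ℚ_[p] × ((({j // j ≠ i} → ℚ_[p]) × ({j // j ≠ i} → ℚ_[p])) × ℚ_[p])) → ℂ),
        ∫ x, f (EE i x) ∂μd = (c i : ℝ) * ∫ z, f z ∂((μ.prod (((Measure.pi fun _ : {j // j ≠ i} => μ).prod (Measure.pi fun _ : {j // j ≠ i} => μ)).prod μ)))) := by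
    intro i f
    have h1 := (EE (p := p) i).toHomeomorph.measurableEmbedding.integral_map (μ := μd) f
    change ∫ y, f y ∂(Measure.map (EE i) μd) = ∫ x, f (EE i x) ∂μd at h1
    rw [← h1, hc i, integral_smul_nnreal_measure]
    simp [NNReal.smul_def]
  refine ⟨fun i => c i, fun i => by exact_mod_cast hc0 i, hint, ?_⟩
  intro Φ hΦ g hg
  have hqc : Continuous (splitQP p ((n + 1) * 2)) := by
    have : splitQP p ((n + 1) * 2) = fun x => qq (EE 0 x) := by ext x; rw [qq_EE]
    rw [this]
    exact qq_cont.comp (EE 0).continuous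
  have hI : Integrable (fun x => g (splitQP p ((n + 1) * 2) x) * Φ x) μd := SB_integrable _ (hg.comp hqc) hΦ
  have h0 : ∀ᵐ x ∂μd, x (finProdFinEquiv ((0 : Fin (n + 1)), 0)) ≠ 0 := by
    have h0 : ∀ᵐ a ∂μ, a ≠ 0 := by simp [ae_iff]
    have h1 : ∀ᵐ z ∂(μ.prod (((Measure.pi fun _ : {j : Fin (n + 1) // j ≠ 0} => μ).prod (Measure.pi fun _ : {j : Fin (n + 1) // j ≠ 0} => μ)).prod μ)), z.1 ≠ 0 :=
      Measure.quasiMeasurePreserving_fst.ae h0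
    have h2 : ∀ᵐ z ∂(Measure.map (EE 0) μd), z.1 ≠ 0 := by
      rw [hc 0]
      exact Measure.ae_smul_measure h1 (c 0)
    exact ae_of_ae_map (EE 0).continuous.measurable.aemeasurable h2
  have hsum : ∀ᵐ x ∂μd, g (splitQP p ((n + 1) * 2) x) * Φ x =
      ∑ i, (cone (CC i)).indicator (fun z => g (qq z) * (Φ ∘ (EE i).symm) z) (EE i x) := by
    filter_upwards [h0] with x hx
    obtain ⟨i, hi, hiu⟩ := exists_cone x 0 hx
    rw [Finset.sum_eq_single i]
    · rw [Set.indicator_of_mem hi, qq_EE]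
      simp
    · intro j _ hj
      rw [Set.indicator_of_notMem]
      exact fun h => hj (hiu j h)
    · simp
  rw [integral_congr_ae hsum, integral_finsetSum]
  · refine Finset.sum_congr rfl fun i _ => ?_
    rw [hint i]
    have hΦi : IsSchwartzBruhat (Φ ∘ (EE i).symm) :=
      ⟨hΦ.1.comp_continuous (EE i).symm.continuous, hΦ.2.comp_homeomorph (EE i).symm.toHomeomorph⟩
    rw [chart μ (CC_clopen i) (CC_compact i) hΦi g hg, card_ne']
  · intro i _
    have hms : MeasurableSet ((EE i) ⁻¹' (cone (CC (p := p) i))) :=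
      (EE i).continuous.measurable (cone_meas (CC_clopen i).1.measurableSet)
    refine (hI.indicator hms).congr (Eventually.of_forall fun x => ?_)
    beta_reduce
    by_cases h : EE i x ∈ cone (CC i)
    · rw [Set.indicator_of_mem h, Set.indicator_of_mem (show x ∈ (EE i) ⁻¹' (cone (CC i)) from h), qq_EE]
      simp
    · rw [Set.indicator_of_notMem h, Set.indicator_of_notMem (show x ∉ (EE i) ⁻¹' (cone (CC i)) from h)]

lemma part1 [MeasurableSpace ℚ_[p]] [BorelSpace ℚ_[p]]
    (μ : Measure ℚ_[p]) [μ.IsAddHaarMeasure] {n : ℕ}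
    (μd : Measure (Fin ((n + 1) * 2) → ℚ_[p])) [μd.IsAddHaarMeasure] 
    (Φ : (Fin ((n + 1) * 2) → ℚ_[p]) → ℂ) (hΦ : IsSchwartzBruhat Φ) :
    ∃ Ψ : ℚ_[p] × ℚ_[p] → ℂ, IsSchwartzBruhat Ψ ∧ ∀ g : ℚ_[p] → ℂ, Continuous g → 
      ∫ x, g (splitQP p ((n + 1) * 2) x) * Φ x ∂μd = Lf μ n Ψ g := by
  obtain ⟨c, -, -, h⟩ := main1 μ μd
  have hS : ∀ i, IsSchwartzBruhat (TT μ (CC i) (Φ ∘ (EE i).symm)) := fun i =>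
    SB_TT μ (CC_clopen i) (CC_compact i) 
      ⟨hΦ.1.comp_continuous (EE i).symm.continuous, hΦ.2.comp_homeomorph (EE i).symm.toHomeomorph⟩
  refine ⟨fun z => ∑ i, (c i : ℂ) * TT μ (CC i) (Φ ∘ (EE i).symm) z, SB_sum _ fun i => SB_smul _ (hS i), fun g hg => ?_⟩
  rw [h Φ hΦ g hg, Lf_sum μ n _ (fun i => SB_smul _ (hS i)) g hg]
  simp only [Lf_smul]

/-- Realizability of a 2-variable function. -/
def R0 [MeasurableSpace ℚ_[p]] (μ : Measure ℚ_[p]) {n : ℕ}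
    (μd : Measure (Fin ((n + 1) * 2) → ℚ_[p])) (Ψ : ℚ_[p] × ℚ_[p] → ℂ) : Prop :=
  ∃ Φ : (Fin ((n + 1) * 2) → ℚ_[p]) → ℂ, IsSchwartzBruhat Φ ∧ ∀ g : ℚ_[p] → ℂ, Continuous g → 
      ∫ x, g (splitQP p ((n + 1) * 2) x) * Φ x ∂μd = Lf μ n Ψ g

lemma splitQP_cont {n : ℕ} : Continuous (splitQP p ((n + 1) * 2)) := by
  have : splitQP p ((n + 1) * 2) = fun x => qq (EE 0 x) := by ext x; rw [qq_EE]
  rw [this]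
  exact qq_cont.comp (EE 0).continuous

lemma R0_add [MeasurableSpace ℚ_[p]] [BorelSpace ℚ_[p]] (μ : Measure ℚ_[p]) [μ.IsAddHaarMeasure] {n : ℕ}
    (μd : Measure (Fin ((n + 1) * 2) → ℚ_[p])) [μd.IsAddHaarMeasure] {Ψ Ψ' : ℚ_[p] × ℚ_[p] → ℂ}
    (h1 : IsSchwartzBruhat Ψ) (h2 : IsSchwartzBruhat Ψ') (h3 : R0 μ μd Ψ) (h4 : R0 μ μd Ψ') :
    R0 μ μd (fun z => Ψ z + Ψ' z) := by
  obtain ⟨Φ, h5, h6⟩ := h3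
  obtain ⟨Φ', h7, h8⟩ := h4
  refine ⟨fun x => Φ x + Φ' x, SB_add h5 h7, fun g hg => ?_⟩
  rw [Lf_add μ n h1 h2 g hg, ← h6 g hg, ← h8 g hg]
  simp only [mul_add]
  exact integral_add (SB_integrable _ (hg.comp splitQP_cont) h5) (SB_integrable _ (hg.comp splitQP_cont) h7)

lemma R0_smul [MeasurableSpace ℚ_[p]] (μ : Measure ℚ_[p]) {n : ℕ}
    (μd : Measure (Fin ((n + 1) * 2) → ℚ_[p])) (c : ℂ) {Ψ : ℚ_[p] × ℚ_[p] → ℂ}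
    (h3 : R0 μ μd Ψ) :
    R0 μ μd (fun z => c * Ψ z) := by
  obtain ⟨Φ, h5, h6⟩ := h3
  refine ⟨fun x => c * Φ x, SB_smul c h5, fun g hg => ?_⟩
  rw [Lf_smul, ← h6 g hg, ← integral_const_mul]
  congr 1; ext x; ring

lemma SB_uniform {X W : Type*} [TopologicalSpace X] [TopologicalSpace W] 
    {F : X × W → ℂ} (hF : IsSchwartzBruhat F) (x : X) : ∃ u : Set X, IsOpen u ∧ x ∈ u ∧ ∀ y ∈ u, ∀ w, F (y, w) = F (x, w) := by
  have hK : IsCompact (tsupport F) := hF.2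
  have hop : IsOpen {z : X × W | F z = F (x, z.2)} := by
    rw [isOpen_iff_mem_nhds]
    rintro ⟨a, w⟩ hz
    have h1 := (IsLocallyConstant.iff_eventually_eq _).1 hF.1 (a, w)
    have h2 := (IsLocallyConstant.iff_eventually_eq _).1 (hF.1.comp_continuous (f := fun z : X × W => (x, z.2)) (by fun_prop)) (a, w)
    filter_upwards [h1, h2] with z h1 h2
    simp only [Set.mem_ofPred_eq, Function.comp] at *
    rw [h1, h2, hz]
  obtain ⟨u, v, hu, hv, hxu, hKv, huv⟩ := generalized_tube_lemma (isCompact_singleton (x := x))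
    (hK.image continuous_snd) hop (by rintro ⟨a, w⟩ ⟨rfl, h⟩; rfl)
  refine ⟨u, hu, hxu rfl, fun y hy w => ?_⟩
  by_cases hw : w ∈ Prod.snd '' tsupport F
  · exact huv ⟨hy, hKv hw⟩
  · have : ∀ a, F (a, w) = 0 := fun a => SB_zero hF fun h => hw ⟨_, h, rfl⟩
    simp [this]

lemma radial_ind (R : (ℚ_[p] → ℂ) → Prop)
    (hb : ∀ (c : ℂ) (k : ℤ), R (fun b => c * (Metric.closedBall (0:ℚ_[p]) ((p:ℝ)^k)).indicator 1 b))
    (ha : ∀ f f', R f → R f' → R (fun b => f b + f' b))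
    (f : ℚ_[p] → ℂ) (hf : IsSchwartzBruhat f) (hr : ∀ b b', ‖b‖ = ‖b'‖ → f b = f b') : R f := by
  have hp1 : (1:ℝ) < p := by exact_mod_cast (Fact.out : p.Prime).one_lt
  have hp0 : (0:ℝ) < p := by linarith
  have key : ∀ (j : ℕ) (k : ℤ) (f : ℚ_[p] → ℂ), (∀ b b', ‖b‖ = ‖b'‖ → f b = f b') →
      (∀ b, ‖b‖ ≤ (p:ℝ)^k → f b = f 0) → (∀ b, (p:ℝ)^(k + j) < ‖b‖ → f b = 0) → R f := by
    intro j k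
    induction j with
    | zero =>
      intro f hr h1 h2
      convert hb (f 0) k using 1
      ext b
      by_cases h : ‖b‖ ≤ (p:ℝ)^k
      · rw [h1 b h, Set.indicator_of_mem (by simpa using h)]; simp
      · rw [Set.indicator_of_notMem (by simpa using h), h2 b (by simpa using h)]; simp
    | succ j ih =>
      intro f hr h1 h2
      set k' : ℤ := k + (j + 1 : ℕ) with hk'
      set b₀ : ℚ_[p] := (p:ℚ_[p])^(-k') with hb0
      have hn : ‖b₀‖ = (p:ℝ)^k' := by rw [hb0, Padic.norm_p_zpow, neg_neg]
      have h3 := ih (fun b => f b - f b₀ * (Metric.closedBall (0:ℚ_[p]) ((p:ℝ)^k')).indicator 1 b) ?_ ?_ ?_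
      · have h4 := ha _ _ h3 (hb (f b₀) k')
        simpa using h4
      · intro b b' hbb
        have hm : b ∈ Metric.closedBall (0:ℚ_[p]) ((p:ℝ)^k') ↔ b' ∈ Metric.closedBall (0:ℚ_[p]) ((p:ℝ)^k') := by
          simp [hbb]
        by_cases h : b' ∈ Metric.closedBall (0:ℚ_[p]) ((p:ℝ)^k')
        · simp only [Set.indicator_of_mem h, Set.indicator_of_mem (hm.2 h), hr b b' hbb, Pi.one_apply]
        · simp only [Set.indicator_of_notMem h, Set.indicator_of_notMem (fun h' => h (hm.1 h')), hr b b' hbb]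
      · intro b hbk
        have : (p:ℝ)^k ≤ (p:ℝ)^k' := zpow_le_zpow_right₀ hp1.le (by lia)
        have h5 : b ∈ Metric.closedBall (0:ℚ_[p]) ((p:ℝ)^k') := by
          rw [mem_closedBall_zero_iff]; linarith
        have h6 : (0:ℚ_[p]) ∈ Metric.closedBall (0:ℚ_[p]) ((p:ℝ)^k') := by
          simp; positivity
        simp only [Set.indicator_of_mem h5, Set.indicator_of_mem h6, h1 b hbk, Pi.one_apply]
      · intro b hbk
        by_cases h : ‖b‖ ≤ (p:ℝ)^k'
        · have h5 : b ∈ Metric.closedBall (0:ℚ_[p]) ((p:ℝ)^k') := by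
            rwa [mem_closedBall_zero_iff]
          have h6 : ‖b‖ = (p:ℝ)^k' := by
            refine le_antisymm h ?_
            by_contra! h7
            have e : k' = k + j + 1 := by push_cast [hk']; ring
            rw [e, ← Padic.norm_le_pow_iff_norm_lt_pow_add_one] at h7
            linarith
          simp [Set.indicator_of_mem h5, hr b b₀ (by rw [h6, hn])]
        · rw [Set.indicator_of_notMem (by simpa using h), h2 b (by simpa using h)]; simp
  obtain ⟨r, hr0, hrr⟩ := (IsCompact.isBounded (s := tsupport f) hf.2).subset_closedBall_lt 0 0
  obtain ⟨u, hu, h0u, hfu⟩ := (IsLocallyConstant.iff_exists_open f).1 hf.1 0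
  obtain ⟨ε, hε, hεu⟩ := Metric.isOpen_iff.1 hu 0 h0u
  obtain ⟨N, hN⟩ := pow_unbounded_of_one_lt r hp1
  obtain ⟨M, hM⟩ := pow_unbounded_of_one_lt (1/ε) hp1
  refine key (M + N) (-M) f hr ?_ ?_
  · intro b hb
    refine hfu b (hεu ?_)
    rw [mem_ball_zero_iff]
    refine lt_of_le_of_lt hb ?_
    rw [zpow_neg, zpow_natCast]
    rw [one_div] at hM
    exact inv_lt_of_inv_lt₀ hε hM
  · intro b hb
    refine SB_zero hf fun h => ?_
    have := hrr h
    rw [mem_closedBall_zero_iff] at this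
    have e : (-M + (M + N : ℕ) : ℤ) = N := by push_cast; ring
    rw [e, zpow_natCast] at hb
    linarith

lemma dot_le {u y : κ → ℚ_[p]} {r : ℝ} (hr : 0 ≤ r) (hu : ‖u‖ ≤ 1) (hy : ‖y‖ ≤ r) : ‖u ⬝ᵥ y‖ ≤ r := by
  refine IsUltrametricDist.norm_sum_le_of_forall_le_of_nonneg hr fun i _ => ?_
  rw [norm_mul]
  have h1 := (norm_le_pi_norm u i).trans hu
  have h2 := (norm_le_pi_norm y i).trans hy
  nlinarith [norm_nonneg (u i), norm_nonneg (y i)]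

lemma K_pos [MeasurableSpace ℚ_[p]] [BorelSpace ℚ_[p]]
    (μ : Measure ℚ_[p]) [μ.IsAddHaarMeasure] {C D : Set (κ → ℚ_[p])} (hC : IsOpen C) (hC2 : IsCompact C)
    (hC3 : C.Nonempty) (hD : IsOpen D) (hD2 : IsCompact D) (hD3 : D.Nonempty) :
    0 < (Measure.pi fun _ : κ => μ).real C * (Measure.pi fun _ : κ => μ).real D := by
  refine mul_pos ?_ ?_
  · exact ENNReal.toReal_pos (hC.measure_pos _ hC3).ne' hC2.measure_lt_top.ne
  · exact ENNReal.toReal_pos (hD.measure_pos _ hD3).ne' hD2.measure_lt_top.ne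

lemma TT_const [MeasurableSpace ℚ_[p]] [BorelSpace ℚ_[p]]
    (μ : Measure ℚ_[p]) [μ.IsAddHaarMeasure] {C D : Set (κ → ℚ_[p])} (hC : MeasurableSet C) (hD : MeasurableSet D)
    (Φ : ℚ_[p] × (((κ → ℚ_[p]) × (κ → ℚ_[p])) × ℚ_[p]) → ℂ) (z : ℚ_[p] × ℚ_[p]) (c : ℂ)
    (h : ∀ u y, u ∈ C → Φ (z.1, fibT z.1 ((u, y), z.2)) = D.indicator 1 y * c) :
    TT μ C Φ z = ((Measure.pi fun _ : κ => μ).real C * (Measure.pi fun _ : κ => μ).real D : ℝ) * c := by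
  have h1 : TT μ C Φ z = ∫ w : (κ → ℚ_[p]) × (κ → ℚ_[p]), C.indicator 1 w.1 * (D.indicator 1 w.2 * c) ∂((Measure.pi fun _ : κ => μ).prod (Measure.pi fun _ : κ => μ)) := by
    unfold TT
    congr 1
    ext ⟨u, y⟩
    by_cases hu : u ∈ C
    · rw [h u y hu]
    · simp [hu]
  rw [h1, integral_prod_mul (C.indicator 1) (fun y => D.indicator 1 y * c), integral_mul_const]
  have hI : ∀ (E : Set (κ → ℚ_[p])), MeasurableSet E → 
      ∫ x, E.indicator (1 : (κ → ℚ_[p]) → ℂ) x ∂(Measure.pi fun _ : κ => μ) = ((Measure.pi fun _ : κ => μ).real E : ℂ) := by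
    intro E hE
    have : E.indicator (1 : (κ → ℚ_[p]) → ℂ) = E.indicator (fun _ => 1) := rfl
    rw [this, integral_indicator_const _ hE]
    simp
  rw [hI C hC, hI D hD]
  push_cast
  ring

lemma far [MeasurableSpace ℚ_[p]] [BorelSpace ℚ_[p]] (μ : Measure ℚ_[p]) [μ.IsAddHaarMeasure] {n : ℕ}
    (μd : Measure (Fin ((n + 1) * 2) → ℚ_[p])) [μd.IsAddHaarMeasure] {Ψ : ℚ_[p] × ℚ_[p] → ℂ}
    (hΨ : IsSchwartzBruhat Ψ) (ε : ℝ) (hε : 0 < ε) :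
    R0 μ μd (fun z => (Metric.closedBall (0:ℚ_[p]) ε)ᶜ.indicator 1 z.1 * Ψ z) := by
  obtain ⟨c, hc0, hci, -⟩ := main1 μ μd
  set A : Set ℚ_[p] := (Metric.closedBall (0:ℚ_[p]) ε)ᶜ with hA
  have hAc : IsClopen A := (IsUltrametricDist.isClopen_closedBall _ hε.ne').compl
  have hA0 : ∀ a ∈ A, a ≠ 0 := by
    rintro a ha rfl
    exact ha (by simp [hε.le])
  set C : Set ({j : Fin (n + 1) // j ≠ 0} → ℚ_[p]) := Metric.closedBall 0 1 with hC
  have hCc : IsClopen C := IsUltrametricDist.isClopen_closedBall _ one_ne_zero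
  have hCk : IsCompact C := isCompact_closedBall 0 1
  set ρ : ℚ_[p] → ℚ_[p] := A.indicator (fun a => a⁻¹) with hρ
  have hρc : Continuous ρ := by
    rw [continuous_iff_continuousAt]
    intro a
    by_cases ha : a ∈ A
    · refine (continuousAt_inv₀ (hA0 a ha)).congr ?_
      filter_upwards [hAc.2.mem_nhds ha] with b hb
      simp [hρ, hb]
    · refine (continuousAt_const (y := (0:ℚ_[p]))).congr ?_
      filter_upwards [hAc.compl.2.mem_nhds ha] with b hb
      simp [hρ, Set.indicator_of_notMem hb]
  set Θ : ℚ_[p] × ((({j : Fin (n + 1) // j ≠ 0} → ℚ_[p]) × ({j : Fin (n + 1) // j ≠ 0} → ℚ_[p])) × ℚ_[p]) → ℂ :=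
    fun z => A.indicator 1 z.1 * Ψ (z.1, z.2.2 + ρ z.1 * (z.2.1.1 ⬝ᵥ z.2.1.2)) * C.indicator 1 (ρ z.1 • z.2.1.1)
      * C.indicator 1 z.2.1.2 with hΘ
  obtain ⟨r, hr0, hrr⟩ := (IsCompact.isBounded (s := tsupport Ψ) hΨ.2).subset_closedBall_lt 0 0
  have hdc : Continuous fun z : ℚ_[p] × ((({j : Fin (n + 1) // j ≠ 0} → ℚ_[p]) × ({j : Fin (n + 1) // j ≠ 0} → ℚ_[p])) × ℚ_[p]) =>
      z.2.1.1 ⬝ᵥ z.2.1.2 := by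
    exact Continuous.dotProduct (by fun_prop) (by fun_prop)
  have hΘs : IsSchwartzBruhat Θ := by
    refine SB_intro (K := Metric.closedBall 0 (r + 1)) ?_ (isCompact_closedBall _ _) ?_
    · refine IsLocallyConstant.mul (IsLocallyConstant.mul (IsLocallyConstant.mul ?_ ?_) ?_) ?_
      · exact (lc_ind hAc).comp_continuous continuous_fst
      · exact hΨ.1.comp_continuous (by fun_prop)
      · exact (lc_ind hCc).comp_continuous (by fun_prop)
      · exact (lc_ind hCc).comp_continuous (by fun_prop)
    · rintro ⟨a, ⟨x, y⟩, b⟩ hz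
      by_contra hne
      apply hz
      simp only [hΘ, ne_eq, mul_eq_zero, not_or] at hne
      obtain ⟨⟨⟨h1, h2⟩, h3⟩, h4⟩ := hne
      have h1 := Set.mem_of_indicator_ne_zero h1
      have h3 := Set.mem_of_indicator_ne_zero h3
      have h4 := Set.mem_of_indicator_ne_zero h4
      have h5 := hrr (not_imp_comm.1 (SB_zero hΨ) h2)
      simp only [hC, mem_closedBall_zero_iff, Prod.norm_def, max_le_iff] at h3 h4 h5 ⊢
      have hρa : ρ a = a⁻¹ := by simp [hρ, h1]
      rw [hρa] at h3 h5
      have ha0 := hA0 a h1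
      have h6 : ‖a⁻¹ * (x ⬝ᵥ y)‖ ≤ 1 := by
        rw [← smul_eq_mul, ← smul_dotProduct]
        exact dot_le zero_le_one h3 h4
      have h7 : ‖x‖ ≤ ‖a‖ := by
        rw [norm_smul, norm_inv, inv_mul_le_iff₀ (norm_pos_iff.2 ha0)] at h3
        linarith
      refine ⟨by linarith, ⟨by linarith, by linarith⟩, ?_⟩
      have := norm_sub_le (b + a⁻¹ * (x ⬝ᵥ y)) (a⁻¹ * (x ⬝ᵥ y))
      rw [add_sub_cancel_right] at this
      linarith
  set K : ℝ := (Measure.pi fun _ : {j : Fin (n + 1) // j ≠ 0} => μ).real C * (Measure.pi fun _ : {j : Fin (n + 1) // j ≠ 0} => μ).real C with hK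
  have hK0 : 0 < K := K_pos μ hCc.2 hCk ⟨0, by simp [hC]⟩ hCc.2 hCk ⟨0, by simp [hC]⟩
  have hTT : TT μ C Θ = fun z => (K : ℂ) * (A.indicator 1 z.1 * Ψ z) := by
    ext ⟨a, b⟩
    refine TT_const μ hCc.1.measurableSet hCc.1.measurableSet Θ (a, b) _ ?_
    intro u y hu
    simp only [hΘ, fibT]
    by_cases ha : a ∈ A
    · have hρa : ρ a = a⁻¹ := by simp [hρ, ha]
      have ha0 := hA0 a ha
      rw [hρa, smul_smul, inv_mul_cancel₀ ha0, one_smul, smul_dotProduct, smul_eq_mul, ← mul_assoc,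
        inv_mul_cancel₀ ha0, one_mul, sub_add_cancel, Set.indicator_of_mem hu]
      simp only [Pi.one_apply]
      ring
    · simp [ha]
  have hmul : ∀ g : ℚ_[p] → ℂ, Continuous g → 
      ∫ x, g (splitQP p ((n + 1) * 2) x) * Θ (EE 0 x) ∂μd = c 0 * (K * Lf μ n (fun z => A.indicator 1 z.1 * Ψ z) g) := by
    intro g hg
    have h1 := hci 0 (fun z => g (qq z) * Θ z)
    simp only [qq_EE] at h1
    rw [h1]
    congr 1
    have hch := chart μ hCc hCk hΘs g hg
    rw [card_ne' (0 : Fin (n + 1))] at hch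
    rw [← Lf_smul, ← hTT, ← hch]
    congr 1
    ext z
    by_cases hz : z ∈ cone C
    · rw [Set.indicator_of_mem hz]
    · rw [Set.indicator_of_notMem hz]
      have : Θ z = 0 := by
        by_contra hne
        apply hz
        simp only [hΘ, ne_eq, mul_eq_zero, not_or] at hne
        obtain ⟨⟨⟨h1, h2⟩, h3⟩, h4⟩ := hne
        have h1 := Set.mem_of_indicator_ne_zero h1
        have h3 := Set.mem_of_indicator_ne_zero h3
        have hρa : ρ z.1 = z.1⁻¹ := by simp [hρ, h1]
        rw [hρa] at h3
        exact ⟨hA0 _ h1, h3⟩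
      rw [this, mul_zero]
  have hΦs : IsSchwartzBruhat (Θ ∘ (EE 0)) :=
      ⟨hΘs.1.comp_continuous (EE 0).continuous, hΘs.2.comp_homeomorph (EE 0).toHomeomorph⟩
  refine ⟨fun x => ((c 0 * K : ℝ) : ℂ)⁻¹ * (Θ ∘ (EE 0)) x, SB_smul _ hΦs, fun g hg => ?_⟩
  have hne : ((c 0 * K : ℝ) : ℂ) ≠ 0 := by
    exact_mod_cast (mul_pos (hc0 0) hK0).ne'
  rw [eq_comm, ← mul_right_inj' hne, eq_comm, ← integral_const_mul]
  have := hmul g hg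
  push_cast at this ⊢
  rw [mul_assoc, ← this]
  congr 1
  ext x
  push_cast at hne
  simp only [Function.comp]
  rw [mul_left_comm, mul_inv_cancel_left₀ hne]

lemma near_base [MeasurableSpace ℚ_[p]] [BorelSpace ℚ_[p]] (μ : Measure ℚ_[p]) [μ.IsAddHaarMeasure] {n : ℕ}
    (μd : Measure (Fin ((n + 1) * 2) → ℚ_[p])) [μd.IsAddHaarMeasure] 
    (ε r : ℝ) (hε : 0 < ε) (hr : 0 < r) :
    R0 μ μd (fun z => (Metric.closedBall (0:ℚ_[p]) ε).indicator 1 z.1 * (Metric.closedBall (0:ℚ_[p]) r).indicator 1 z.2) := by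
  obtain ⟨c, hc0, -, hmain⟩ := main1 μ μd
  set S : Set (Fin ((n + 1) * 2) → ℚ_[p]) := Set.univ.pi fun k => Metric.closedBall 0 
    (if (finProdFinEquiv.symm k).2 = 0 then ε else r) with hS
  have hpos : ∀ k : Fin ((n + 1) * 2), (if (finProdFinEquiv.symm k).2 = 0 then ε else r) ≠ 0 := by
    intro k; split_ifs <;> [exact hε.ne'; exact hr.ne']
  have hSc : IsClopen S := 
    ⟨isClosed_set_pi fun j _ => (IsUltrametricDist.isClopen_closedBall _ (hpos j)).1,
     isOpen_set_pi Set.finite_univ fun j _ => (IsUltrametricDist.isClopen_closedBall _ (hpos j)).2⟩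
  have hSk : IsCompact S := isCompact_univ_pi fun k => isCompact_closedBall _ _
  have hmem : ∀ (i : Fin (n + 1)) z, (EE i).symm z ∈ S ↔ (‖z.1‖ ≤ ε ∧ ‖z.2.1.1‖ ≤ ε) ∧ ‖z.2.1.2‖ ≤ r ∧ ‖z.2.2‖ ≤ r := by
    intro i z
    obtain ⟨x, rfl⟩ := (EE (p := p) i).surjective z
    rw [ContinuousLinearEquiv.symm_apply_apply, EE_apply]
    simp only [pi_norm_le_iff_of_nonneg hε.le, pi_norm_le_iff_of_nonneg hr.le, hS, Set.mem_univ_pi,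
      mem_closedBall_zero_iff]
    constructor
    · intro h
      have h0 : ∀ j, ‖x (finProdFinEquiv (j, 0))‖ ≤ ε := fun j => by simpa using h (finProdFinEquiv (j, 0))
      have h1 : ∀ j, ‖x (finProdFinEquiv (j, 1))‖ ≤ r := fun j => by simpa using h (finProdFinEquiv (j, 1))
      exact ⟨⟨h0 _, fun j => h0 _⟩, fun j => h1 _, h1 _⟩
    · rintro ⟨⟨h1, h2⟩, h3, h4⟩ k
      obtain ⟨⟨j, s⟩, rfl⟩ := finProdFinEquiv.surjective k
      simp only [Equiv.symm_apply_apply]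
      by_cases hj : j = i
      · subst hj
        fin_cases s
        · simpa using h1
        · simpa using h4
      · fin_cases s
        · simpa using h2 ⟨j, hj⟩
        · simpa using h3 ⟨j, hj⟩
  have hΦ : IsSchwartzBruhat (S.indicator (1 : (Fin ((n + 1) * 2) → ℚ_[p]) → ℂ)) :=
    SB_intro (lc_ind hSc) hSk fun x hx => Set.indicator_of_notMem hx _
  set K : Fin (n + 1) → ℝ := fun i => (Measure.pi fun _ : {j // j ≠ i} => μ).real (CC i) * 
    (Measure.pi fun _ : {j // j ≠ i} => μ).real (Metric.closedBall 0 r) with hK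
  have hK0 : ∀ i, 0 < K i := by
    intro i
    refine K_pos μ (CC_clopen i).2 (CC_compact i) ⟨0, ?_⟩ (IsUltrametricDist.isClopen_closedBall _ hr.ne').2
      (isCompact_closedBall _ _) ⟨0, by simp [hr.le]⟩
    intro j _
    simp only
    split_ifs <;> simp
  have hTT : ∀ i, TT μ (CC i) (S.indicator 1 ∘ (EE i).symm) = fun z => (K i : ℂ) * 
      ((Metric.closedBall (0:ℚ_[p]) ε).indicator 1 z.1 * (Metric.closedBall (0:ℚ_[p]) r).indicator 1 z.2) := by
    intro i
    ext ⟨a, b⟩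
    refine TT_const μ (CC_clopen i).1.measurableSet Metric.isClosed_closedBall.measurableSet _ (a, b) _ ?_
    intro u y hu
    have hu1 := CC_sub i hu
    have hiff : (EE i).symm (a, fibT a ((u, y), b)) ∈ S ↔ (y ∈ Metric.closedBall 0 r ∧ a ∈ Metric.closedBall 0 ε ∧ b ∈ Metric.closedBall 0 r) := by
      rw [hmem]
      simp only [fibT, mem_closedBall_zero_iff]
      have h1 : ‖a‖ ≤ ε → ‖a • u‖ ≤ ε := by
        intro h
        rw [norm_smul]
        nlinarith [norm_nonneg a, norm_nonneg u]
      constructor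
      · rintro ⟨⟨h2, h3⟩, h4, h5⟩
        refine ⟨h4, h2, ?_⟩
        have h6 := dot_le hr.le hu1 h4
        have h7 := IsUltrametricDist.norm_add_le_max (b - u ⬝ᵥ y) (u ⬝ᵥ y)
        rw [sub_add_cancel] at h7
        exact h7.trans (max_le h5 h6)
      · rintro ⟨h4, h2, h5⟩
        have h6 := dot_le hr.le hu1 h4
        have h7 := IsUltrametricDist.norm_add_le_max b (-(u ⬝ᵥ y))
        rw [norm_neg, ← sub_eq_add_neg] at h7
        exact ⟨⟨h2, h1 h2⟩, h4, h7.trans (max_le h5 h6)⟩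
    classical
    simp only [Function.comp, Set.indicator_apply, hiff, Pi.one_apply]
    by_cases h1 : y ∈ Metric.closedBall 0 r <;> by_cases h2 : a ∈ Metric.closedBall 0 ε <;>
      by_cases h3 : b ∈ Metric.closedBall 0 r <;> simp only [h1, h2, h3] <;> simp
  have hsum : 0 < ∑ i, c i * K i := Finset.sum_pos (fun i _ => mul_pos (hc0 i) (hK0 i)) Finset.univ_nonempty
  have hne : ((∑ i, c i * K i : ℝ) : ℂ) ≠ 0 := by exact_mod_cast hsum.ne'
  refine ⟨fun x => ((∑ i, c i * K i : ℝ) : ℂ)⁻¹ * S.indicator 1 x, SB_smul _ hΦ, fun g hg => ?_⟩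
  have h := hmain _ hΦ g hg
  simp only [hTT, Lf_smul] at h
  simp only [← mul_assoc, ← Finset.sum_mul] at h
  have e : ∀ x, g (splitQP p ((n + 1) * 2) x) * (((∑ i, c i * K i : ℝ) : ℂ)⁻¹ * S.indicator 1 x) = 
    ((∑ i, c i * K i : ℝ) : ℂ)⁻¹ * (g (splitQP p ((n + 1) * 2) x) * S.indicator 1 x) := fun x => by ring
  simp only [e]
  rw [integral_const_mul, h]
  push_cast at hne ⊢
  rw [← mul_assoc, inv_mul_cancel₀ hne, one_mul]

lemma mp_unit [MeasurableSpace ℚ_[p]] [BorelSpace ℚ_[p]] (μ : Measure ℚ_[p]) [μ.IsAddHaarMeasure]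
    (t : ℚ_[p]) (ht : ‖t‖ = 1) : MeasurePreserving (fun u => t * u) μ μ := by
  refine ⟨by fun_prop, ?_⟩
  have h := map_mul_one μ t (by rintro rfl; simp at ht)
  rwa [ht, ENNReal.ofReal_one, one_smul] at h

/-- average over units -/
noncomputable def avg [MeasurableSpace ℚ_[p]] (μ : Measure ℚ_[p]) (f : ℚ_[p] → ℂ) (b : ℚ_[p]) : ℂ :=
  ∫ t, (Metric.sphere (0:ℚ_[p]) 1).indicator 1 t * f (t * b) ∂μ

lemma SB_avg [MeasurableSpace ℚ_[p]] [BorelSpace ℚ_[p]] (μ : Measure ℚ_[p]) [μ.IsAddHaarMeasure]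
    {f : ℚ_[p] → ℂ} (hf : IsSchwartzBruhat f) : IsSchwartzBruhat (avg μ f) := by
  obtain ⟨r, hr0, hrr⟩ := (IsCompact.isBounded (s := tsupport f) hf.2).subset_closedBall_lt 0 0
  refine SB_integral μ (F := fun z : ℚ_[p] × ℚ_[p] => (Metric.sphere (0:ℚ_[p]) 1).indicator 1 z.2 * f (z.2 * z.1)) ?_
  refine SB_intro (K := Metric.closedBall 0 r ×ˢ Metric.closedBall 0 1) ?_
    ((isCompact_closedBall _ _).prod (isCompact_closedBall _ _)) ?_
  · refine IsLocallyConstant.mul ?_ ?_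
    · exact (lc_ind (IsUltrametricDist.isClopen_sphere _ one_ne_zero)).comp_continuous continuous_snd
    · exact hf.1.comp_continuous (by fun_prop)
  · rintro ⟨b, t⟩ hz
    by_contra hne
    apply hz
    simp only [ne_eq, mul_eq_zero, not_or] at hne
    have h1 := Set.mem_of_indicator_ne_zero hne.1
    have h2 := hrr (not_imp_comm.1 (SB_zero hf) hne.2)
    rw [mem_sphere_zero_iff_norm] at h1
    rw [mem_closedBall_zero_iff, norm_mul, h1, one_mul] at h2
    simp [h1, h2]

lemma avg_radial [MeasurableSpace ℚ_[p]] [BorelSpace ℚ_[p]] (μ : Measure ℚ_[p]) [μ.IsAddHaarMeasure]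
    (f : ℚ_[p] → ℂ) (b b' : ℚ_[p]) (h : ‖b‖ = ‖b'‖) : avg μ f b = avg μ f b' := by
  by_cases hb : b' = 0
  · subst hb
    rw [norm_zero, norm_eq_zero] at h
    rw [h]
  have hs : ‖b / b'‖ = 1 := by rw [norm_div, h, div_self (norm_ne_zero_iff.2 hb)]
  have hs0 : b / b' ≠ 0 := by intro h0; simp [h0] at hs
  have h1 := (mp_unit μ _ hs).integral_comp (Homeomorph.mulLeft₀ _ hs0).measurableEmbedding
    (fun t => (Metric.sphere (0:ℚ_[p]) 1).indicator 1 t * f (t * b'))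
  unfold avg
  rw [← h1]
  congr 1
  ext t
  have e : b / b' * t * b' = t * b := by field_simp
  have e2 : b / b' * t ∈ Metric.sphere (0:ℚ_[p]) 1 ↔ t ∈ Metric.sphere (0:ℚ_[p]) 1 := by
    rw [mem_sphere_zero_iff_norm, mem_sphere_zero_iff_norm, norm_mul, hs, one_mul]
  classical
  simp only [e, Set.indicator_apply, e2, Pi.one_apply]

lemma SB_tensor {f : ℚ_[p] → ℂ} (hf : IsSchwartzBruhat f) {ε : ℝ} (hε : 0 < ε) :
    IsSchwartzBruhat (fun z : ℚ_[p] × ℚ_[p] => (Metric.closedBall (0:ℚ_[p]) ε).indicator 1 z.1 * f z.2) := by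
  refine SB_intro (K := Metric.closedBall 0 ε ×ˢ tsupport f) ?_ ((isCompact_closedBall _ _).prod hf.2) ?_
  · exact IsLocallyConstant.mul ((lc_ind (IsUltrametricDist.isClopen_closedBall _ hε.ne')).comp_continuous continuous_fst)
      (hf.1.comp_continuous continuous_snd)
  · rintro ⟨a, b⟩ hz
    by_contra hne
    apply hz
    simp only [ne_eq, mul_eq_zero, not_or] at hne
    exact ⟨Set.mem_of_indicator_ne_zero hne.1, not_imp_comm.1 (SB_zero hf) hne.2⟩

lemma Lf_avg [MeasurableSpace ℚ_[p]] [BorelSpace ℚ_[p]] (μ : Measure ℚ_[p]) [μ.IsAddHaarMeasure] (n : ℕ)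
    {f : ℚ_[p] → ℂ} (hf : IsSchwartzBruhat f) {ε : ℝ} (hε : 0 < ε) (g : ℚ_[p] → ℂ) (hg : Continuous g) :
    Lf μ n (fun z => (Metric.closedBall (0:ℚ_[p]) ε).indicator 1 z.1 * avg μ f z.2) g =
      (μ.real (Metric.sphere (0:ℚ_[p]) 1) : ℂ) * Lf μ n (fun z => (Metric.closedBall (0:ℚ_[p]) ε).indicator 1 z.1 * f z.2) g := by
  set U : Set ℚ_[p] := Metric.sphere (0:ℚ_[p]) 1 with hU
  set B : Set ℚ_[p] := Metric.closedBall (0:ℚ_[p]) ε with hB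
  have hBc : IsClopen B := IsUltrametricDist.isClopen_closedBall _ hε.ne'
  have hUc : IsClopen U := IsUltrametricDist.isClopen_sphere _ one_ne_zero
  obtain ⟨r, hr0, hrr⟩ := (IsCompact.isBounded (s := tsupport f) hf.2).subset_closedBall_lt 0 0
  set F : (ℚ_[p] × ℚ_[p]) × ℚ_[p] → ℂ := fun z => B.indicator 1 z.1.1 * (U.indicator 1 z.2 * f (z.2 * z.1.2)) with hF
  have hFs : IsSchwartzBruhat F := by
    refine SB_intro (K := (B ×ˢ Metric.closedBall 0 r) ×ˢ Metric.closedBall 0 1) ?_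
      (((isCompact_closedBall _ _).prod (isCompact_closedBall _ _)).prod (isCompact_closedBall _ _)) ?_
    · refine IsLocallyConstant.mul ?_ (IsLocallyConstant.mul ?_ ?_)
      · exact (lc_ind hBc).comp_continuous (by fun_prop)
      · exact (lc_ind hUc).comp_continuous continuous_snd
      · exact hf.1.comp_continuous (by fun_prop)
    · rintro ⟨⟨a, b⟩, t⟩ hz
      by_contra hne
      apply hz
      simp only [hF, ne_eq, mul_eq_zero, not_or] at hne
      have h0 := Set.mem_of_indicator_ne_zero hne.1
      have h1 := Set.mem_of_indicator_ne_zero hne.2.1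
      have h2 := hrr (not_imp_comm.1 (SB_zero hf) hne.2.2)
      rw [mem_sphere_zero_iff_norm] at h1
      rw [mem_closedBall_zero_iff, norm_mul, h1, one_mul] at h2
      exact ⟨⟨h0, by simpa using h2⟩, by simp [h1]⟩
  have hcF : Continuous fun z : (ℚ_[p] × ℚ_[p]) × ℚ_[p] => (‖z.1.1‖ : ℂ) ^ n * g (z.1.1 * z.1.2) := by fun_prop
  have hI := SB_integrable ((μ.prod μ).prod μ) hcF hFs
  have h1 : Lf μ n (fun z => B.indicator 1 z.1 * avg μ f z.2) g =
      ∫ z, ∫ t, (‖z.1‖ : ℂ) ^ n * g (z.1 * z.2) * F (z, t) ∂μ ∂(μ.prod μ) := by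
    unfold Lf avg
    congr 1
    ext z
    simp only [hF, integral_const_mul, hU]
  rw [h1, integral_integral_swap hI]
  have h2 : ∀ t, ∫ z, (‖z.1‖ : ℂ) ^ n * g (z.1 * z.2) * F (z, t) ∂(μ.prod μ) =
      U.indicator (fun _ => Lf μ n (fun z => B.indicator 1 z.1 * f z.2) g) t := by
    intro t
    by_cases ht : t ∈ U
    · rw [Set.indicator_of_mem ht]
      have htn : ‖t‖ = 1 := mem_sphere_zero_iff_norm.1 ht
      have ht0 : t ≠ 0 := by rintro rfl; simp at htn
      have hmp := (mp_unit μ t⁻¹ (by simp [htn])).prod (mp_unit μ t htn)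
      have h3 := hmp.integral_comp
        ((Homeomorph.mulLeft₀ _ (inv_ne_zero ht0)).prodCongr (Homeomorph.mulLeft₀ _ ht0)).measurableEmbedding
        (fun z : ℚ_[p] × ℚ_[p] => (‖z.1‖ : ℂ) ^ n * g (z.1 * z.2) * (B.indicator 1 z.1 * f z.2))
      unfold Lf
      rw [← h3]
      congr 1
      ext ⟨a, b⟩
      have e : t⁻¹ * a * (t * b) = a * b := by field_simp
      have e2 : t⁻¹ * a ∈ B ↔ a ∈ B := by
        rw [mem_closedBall_zero_iff, mem_closedBall_zero_iff, norm_mul, norm_inv, htn, inv_one, one_mul]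
      have e3 : ‖t⁻¹ * a‖ = ‖a‖ := by rw [norm_mul, norm_inv, htn, inv_one, one_mul]
      classical
      simp only [hF, Prod.map, e, e3, Set.indicator_apply, e2, ht, if_true, Pi.one_apply, one_mul]
    · simp [hF, ht]
  simp only [h2]
  rw [integral_indicator_const _ hUc.1.measurableSet]
  simp

lemma near [MeasurableSpace ℚ_[p]] [BorelSpace ℚ_[p]] (μ : Measure ℚ_[p]) [μ.IsAddHaarMeasure] {n : ℕ}
    (μd : Measure (Fin ((n + 1) * 2) → ℚ_[p])) [μd.IsAddHaarMeasure] 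
    {f : ℚ_[p] → ℂ} (hf : IsSchwartzBruhat f) {ε : ℝ} (hε : 0 < ε) :
    R0 μ μd (fun z => (Metric.closedBall (0:ℚ_[p]) ε).indicator 1 z.1 * f z.2) := by
  have hp0 : (0:ℝ) < p := by exact_mod_cast (Fact.out : p.Prime).pos
  have h1 := radial_ind (fun f : ℚ_[p] → ℂ => IsSchwartzBruhat f ∧ 
    R0 μ μd (fun z => (Metric.closedBall (0:ℚ_[p]) ε).indicator 1 z.1 * f z.2)) ?_ ?_ (avg μ f) (SB_avg μ hf) (avg_radial μ f)
  · obtain ⟨Φ, hΦ, h⟩ := h1.2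
    have hUc : IsClopen (Metric.sphere (0:ℚ_[p]) 1) := IsUltrametricDist.isClopen_sphere _ one_ne_zero
    have hK : 0 < μ.real (Metric.sphere (0:ℚ_[p]) 1) :=
      ENNReal.toReal_pos (hUc.2.measure_pos _ ⟨1, by simp⟩).ne' (isCompact_sphere _ _).measure_lt_top.ne
    have hne : (μ.real (Metric.sphere (0:ℚ_[p]) 1) : ℂ) ≠ 0 := by exact_mod_cast hK.ne'
    refine ⟨fun x => (μ.real (Metric.sphere (0:ℚ_[p]) 1) : ℂ)⁻¹ * Φ x, SB_smul _ hΦ, fun g hg => ?_⟩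
    have h2 := h g hg
    rw [Lf_avg μ n hf hε g hg] at h2
    simp only [mul_left_comm (g _)]
    rw [integral_const_mul, h2, inv_mul_cancel_left₀ hne]
  · intro c k
    have hpk : (0:ℝ) < (p:ℝ)^k := by positivity
    have hs : IsSchwartzBruhat ((Metric.closedBall (0:ℚ_[p]) ((p:ℝ)^k)).indicator (1 : ℚ_[p] → ℂ)) :=
      SB_intro (lc_ind (IsUltrametricDist.isClopen_closedBall _ hpk.ne')) (isCompact_closedBall _ _)
        fun x hx => Set.indicator_of_notMem hx _
    refine ⟨SB_smul c hs, ?_⟩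
    have := R0_smul μ μd c (near_base μ μd ε _ hε hpk)
    simpa only [mul_left_comm c] using this
  · rintro f f' ⟨h1, h2⟩ ⟨h3, h4⟩
    refine ⟨SB_add h1 h3, ?_⟩
    have := R0_add μ μd (SB_tensor h1 hε) (SB_tensor h3 hε) h2 h4
    simpa only [mul_add] using this

lemma part2 [MeasurableSpace ℚ_[p]] [BorelSpace ℚ_[p]] (μ : Measure ℚ_[p]) [μ.IsAddHaarMeasure] {n : ℕ}
    (μd : Measure (Fin ((n + 1) * 2) → ℚ_[p])) [μd.IsAddHaarMeasure] 
    {Ψ : ℚ_[p] × ℚ_[p] → ℂ} (hΨ : IsSchwartzBruhat Ψ) : R0 μ μd Ψ := by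
  obtain ⟨u, hu, h0u, hfu⟩ := SB_uniform hΨ 0
  obtain ⟨ε', hε', hεu⟩ := Metric.isOpen_iff.1 hu 0 h0u
  set ε := ε' / 2 with hεd
  have hε : 0 < ε := by positivity
  have hBu : ∀ a ∈ Metric.closedBall (0:ℚ_[p]) ε, ∀ b, Ψ (a, b) = Ψ (0, b) := by
    intro a ha b
    refine hfu a (hεu ?_) b
    rw [mem_closedBall_zero_iff] at ha
    rw [mem_ball_zero_iff]; linarith
  have hBc : IsClopen (Metric.closedBall (0:ℚ_[p]) ε) := IsUltrametricDist.isClopen_closedBall _ hε.ne'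
  have hf : IsSchwartzBruhat (fun b => Ψ (0, b)) := by
    refine SB_intro (K := Prod.snd '' tsupport Ψ) (hΨ.1.comp_continuous (by fun_prop)) (IsCompact.image hΨ.2 continuous_snd) ?_
    intro b hb
    exact SB_zero hΨ fun h => hb ⟨_, h, rfl⟩
  have hs : IsSchwartzBruhat (fun z => (Metric.closedBall (0:ℚ_[p]) ε)ᶜ.indicator 1 z.1 * Ψ z) := by
    refine SB_intro (K := tsupport Ψ) ?_ hΨ.2 ?_
    · exact IsLocallyConstant.mul ((lc_ind hBc.compl).comp_continuous continuous_fst) hΨ.1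
    · intro z hz
      rw [SB_zero hΨ hz, mul_zero]
  have := R0_add μ μd hs (SB_tensor hf hε) (far μ μd hΨ ε hε) (near μ μd hf hε)
  convert this using 1
  ext ⟨a, b⟩
  by_cases ha : a ∈ Metric.closedBall (0:ℚ_[p]) ε
  · simp only [Set.indicator_of_mem ha, Set.indicator_of_notMem (Set.notMem_compl_iff.2 ha), hBu a ha b]
    simp
  · simp only [Set.indicator_of_notMem ha, Set.indicator_of_mem (show a ∈ (Metric.closedBall (0:ℚ_[p]) ε)ᶜ from ha)]
    simp

end aux

/-- `p`-adic, even-dimensional case of the reduction of pushforwards under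
the split quadratic form in `d` variables to twisted pushforwards in `2` variables. -/
theorem pushforward_eq_twisted_pushforward_padic_even (p : ℕ) [Fact p.Prime]
    [MeasurableSpace ℚ_[p]] [BorelSpace ℚ_[p]]
    (μ : Measure ℚ_[p]) [μ.IsAddHaarMeasure]
    (d : ℕ) (hd : 2 ≤ d) (hde : Even d)
    (μd : Measure (Fin d → ℚ_[p])) [μd.IsAddHaarMeasure] :
    (∀ Φ₂ : ℚ_[p] × ℚ_[p] → ℂ, IsSchwartzBruhat Φ₂ →
      (∀ ξ : ℚ_[p], ξ ≠ 0 → IntegrableOn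
          (fun a : ℚ_[p] => Φ₂ (a, ξ / a) * ((‖a‖ ^ (((d : ℝ) - 2) / 2) / ‖a‖ : ℝ) : ℂ))
          ({0}ᶜ : Set ℚ_[p]) μ) ∧
      LocallyIntegrable (hTwoP p μ d Φ₂) μ) ∧
    (∀ Φ : (Fin d → ℚ_[p]) → ℂ, IsSchwartzBruhat Φ →
      ∃ Φ₂ : ℚ_[p] × ℚ_[p] → ℂ, IsSchwartzBruhat Φ₂ ∧
        ∀ g : ℚ_[p] → ℂ, Continuous g → HasCompactSupport g →
          ∫ x, g (splitQP p d x) * Φ x ∂μd = ∫ ξ, g ξ * hTwoP p μ d Φ₂ ξ ∂μ) ∧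
    (∀ Φ₂ : ℚ_[p] × ℚ_[p] → ℂ, IsSchwartzBruhat Φ₂ →
      ∃ Φ : (Fin d → ℚ_[p]) → ℂ, IsSchwartzBruhat Φ ∧
        ∀ g : ℚ_[p] → ℂ, Continuous g → HasCompactSupport g →
          ∫ x, g (splitQP p d x) * Φ x ∂μd = ∫ ξ, g ξ * hTwoP p μ d Φ₂ ξ ∂μ) := by
  obtain ⟨n, rfl⟩ : ∃ n, d = (n + 1) * 2 := by
    obtain ⟨k, rfl⟩ := hde
    exact ⟨k - 1, by lia⟩
  refine ⟨fun Φ₂ hΦ₂ => ⟨fun ξ hξ => ?_, (part0b μ n hΦ₂).locallyIntegrable⟩, ?_, ?_⟩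
  · have h := part0a μ n hΦ₂ ξ hξ
    have e : ((((n + 1) * 2 : ℕ) : ℝ) - 2) / 2 = (n : ℝ) := by push_cast; ring
    simp only [e, Real.rpow_natCast]
    exact h.integrableOn
  · intro Φ hΦ
    obtain ⟨Ψ, h1, h2⟩ := part1 μ μd Φ hΦ
    exact ⟨Ψ, h1, fun g hg _ => by rw [h2 g hg, partB μ n h1 g hg]⟩
  · intro Ψ hΨ
    obtain ⟨Φ, h1, h2⟩ := part2 μ μd hΨ
    exact ⟨Φ, h1, fun g hg _ => by rw [h2 g hg, partB μ n hΨ g hg]⟩
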